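/- Addition theorem for tameness II: Let A be an essential hyperplane arrangement in V = K^ℓ, let H ∈ A, and set A' = A∖{H}. Assume that the restricted arrangement A^H is tame and that A' is locally free along H. Then A is tame whenever A' is tame. -/

import Mathlib

noncomputable section
open Classical MvPolynomial

/-- `pdLE R n M` : the `R`-module `M` has projective dimension at most `n`. -/
def pdLE (R : Type) [CommRing R] : ℕ → (M : Type) → [AddCommGroup M] → [Module R M] → Prop
  | 0, M, _, _ => Module.Projective R M
  | n + 1, M, _, _ => ∃ (ι : Type) (f : (ι →₀ R) →ₗ[R] M),
      Function.Surjective f ∧ pdLE R n (LinearMap.ker f)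

/-- Projective dimension as an element of `ℕ∞`. -/
def pdim (R : Type) [CommRing R] (M : Type) [AddCommGroup M] [Module R M] : ℕ∞ :=
  sInf {n : ℕ∞ | ∃ k : ℕ, pdLE R k M ∧ n = (k : ℕ∞)}

/-- The coordinate ring `S = K[x_1, …, x_ℓ]`. -/
abbrev PS (K : Type) [Field K] (ℓ : ℕ) : Type := MvPolynomial (Fin ℓ) K

/-- The free `S`-module of polynomial differential forms of all degrees, realized as the
exterior algebra over `S` on the free module `S^ℓ` (with `dx_i` the standard basis). -/
abbrev ExtF (K : Type) [Field K] (ℓ : ℕ) : Type :=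
  ExteriorAlgebra (PS K ℓ) (Fin ℓ → PS K ℓ)

variable {K : Type} [Field K] {ℓ : ℕ}

/-- The module `Ω^p_V` of polynomial differential `p`-forms. -/
def formsP (K : Type) [Field K] (ℓ : ℕ) (p : ℕ) : Submodule (PS K ℓ) (ExtF K ℓ) :=
  (LinearMap.range (ExteriorAlgebra.ι (PS K ℓ) :
      (Fin ℓ → PS K ℓ) →ₗ[PS K ℓ] ExtF K ℓ)) ^ p

/-- The defining linear form `α = ∑ c_i x_i` of the hyperplane with coefficient vector `c`. -/
def linP (c : Fin ℓ → K) : PS K ℓ := ∑ i, MvPolynomial.C (c i) * MvPolynomial.X i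

/-- The constant one-form `dα = ∑ c_i dx_i`. -/
def dP (c : Fin ℓ → K) : ExtF K ℓ :=
  ExteriorAlgebra.ι (PS K ℓ) (fun i => MvPolynomial.C (c i))

/-- A central hyperplane arrangement in `K^ℓ`: a finite set of (pairwise non-proportional,
nonzero) coefficient vectors of defining linear forms, each representing the hyperplane
`{x : ∑ c_i x_i = 0}`. -/
structure Arrangement (K : Type) [Field K] (ℓ : ℕ) : Type where
  hyps : Finset (Fin ℓ → K)
  ne_zero : ∀ c ∈ hyps, c ≠ 0
  nonprop : ∀ c ∈ hyps, ∀ c' ∈ hyps, c ≠ c' → ∀ t : K, c ≠ t • c'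

/-- The polynomial model of the module `Ω^p(A,m)` of logarithmic `p`-forms of the
multiarrangement `(A,m)`; it is `Q(A,m)·Ω^p(A,m)`, i.e. the image of `Ω^p(A,m)` under the
degree-shifting isomorphism given by multiplication with `Q(A,m)`, so that
`η = Q(A,m)·ω` ranges over polynomial `p`-forms with `dα_H ∧ η ∈ α_H^{m(H)} Ω^{p+1}_V`
for all `H ∈ A`. -/
def Omega (A : Arrangement K ℓ) (m : (Fin ℓ → K) → ℕ) (p : ℕ) :
    Submodule (PS K ℓ) (ExtF K ℓ) :=
  formsP K ℓ p ⊓ ⨅ c ∈ A.hyps,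
    Submodule.comap (LinearMap.mulLeft (PS K ℓ) (dP c))
      (Submodule.map (LinearMap.lsmul (PS K ℓ) (ExtF K ℓ) (linP c ^ m c))
        (formsP K ℓ (p + 1)))

/-- Tameness of a multiarrangement: `pd_S Ω^p(A,m) ≤ p` for all `0 ≤ p ≤ ℓ`. -/
def TameM (A : Arrangement K ℓ) (m : (Fin ℓ → K) → ℕ) : Prop :=
  ∀ p : ℕ, p ≤ ℓ → pdLE (PS K ℓ) p (Omega A m p)

/-- Tameness of a simple arrangement (constant multiplicity `1`). -/
def Tame (A : Arrangement K ℓ) : Prop := TameM A (fun _ => 1)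

/-- Freeness of a multiarrangement: `Ω^1(A,m)` is a free `S`-module. -/
def FreeM (A : Arrangement K ℓ) (m : (Fin ℓ → K) → ℕ) : Prop :=
  Module.Free (PS K ℓ) (Omega A m 1)

/-- An arrangement is essential when the intersection of its hyperplanes is `{0}`,
equivalently the defining forms span the dual space. -/
def Essential (A : Arrangement K ℓ) : Prop :=
  Submodule.span K (A.hyps : Set (Fin ℓ → K)) = ⊤

/-- The localization `A_x = {H ∈ A : x ∈ H}` of an arrangement at a point `x`. -/
def locArr (A : Arrangement K ℓ) (x : Fin ℓ → K) : Arrangement K ℓ where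
  hyps := A.hyps.filter (fun c => ∑ i, c i * x i = 0)
  ne_zero := fun c hc => A.ne_zero c (Finset.mem_filter.mp hc).1
  nonprop := fun c hc c' hc' =>
    A.nonprop c (Finset.mem_filter.mp hc).1 c' (Finset.mem_filter.mp hc').1

/-- `(A,m)` is locally free along the hyperplane `{x : ∑ (c0)_i x_i = 0}` :
`(A_x, m_x)` is free for every nonzero point `x` of this hyperplane. -/
def LocallyFreeAlong (A : Arrangement K ℓ) (m : (Fin ℓ → K) → ℕ) (c0 : Fin ℓ → K) : Prop :=
  ∀ x : Fin ℓ → K, x ≠ 0 → (∑ i, c0 i * x i = 0) → FreeM (locArr A x) m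

/-- The deletion `A ∖ {H}`. -/
def delArr (A : Arrangement K ℓ) (c0 : Fin ℓ → K) : Arrangement K ℓ where
  hyps := A.hyps.erase c0
  ne_zero := fun c hc => A.ne_zero c (Finset.mem_of_mem_erase hc)
  nonprop := fun c hc c' hc' =>
    A.nonprop c (Finset.mem_of_mem_erase hc) c' (Finset.mem_of_mem_erase hc')

/-- The coefficient vector of the restriction of the linear form `c` to the hyperplane `H`
along the linear identification `e : K^{ℓ-1} ≃ H`. -/
def restrictForm (e : (Fin (ℓ - 1) → K) →ₗ[K] (Fin ℓ → K)) (c : Fin ℓ → K) :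
    Fin (ℓ - 1) → K := fun i => ∑ j, c j * e (Pi.single i 1) j

/-- The linear form on `K^ℓ` with coefficient vector `c`. -/
def dotLin (c : Fin ℓ → K) : (Fin ℓ → K) →ₗ[K] K := ∑ i, c i • LinearMap.proj i

/-- `e` identifies `K^{ℓ-1}` with the hyperplane `ker(α_{c0})`. -/
def IsHypEmbedding (c0 : Fin ℓ → K) (e : (Fin (ℓ - 1) → K) →ₗ[K] (Fin ℓ → K)) : Prop :=
  Function.Injective e ∧ LinearMap.range e = LinearMap.ker (dotLin c0)

/-- `B` (an arrangement in `K^{ℓ-1}`) represents the restriction `A^H` of `A` to the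
hyperplane `H` determined by `c0 ∈ A`, via the identification `e : K^{ℓ-1} ≃ H`:
its hyperplanes are exactly the restrictions to `H` of the hyperplanes of `A ∖ {H}`. -/
def IsRestrictionOf (B : Arrangement K (ℓ - 1)) (A : Arrangement K ℓ) (c0 : Fin ℓ → K)
    (e : (Fin (ℓ - 1) → K) →ₗ[K] (Fin ℓ → K)) : Prop :=
  (∀ c ∈ A.hyps, c ≠ c0 → ∃ c' ∈ B.hyps, ∃ t : K, t ≠ 0 ∧ restrictForm e c = t • c') ∧
  (∀ c' ∈ B.hyps, ∃ c ∈ A.hyps, c ≠ c0 ∧ ∃ t : K, t ≠ 0 ∧ restrictForm e c = t • c')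
/-- The Ziegler multiplicity `m^H` on the restriction: `m^H(X) = #{L ∈ A∖{H} : L ∩ H = X}`. -/
def zieglerMult (A : Arrangement K ℓ) (c0 : Fin ℓ → K)
    (e : (Fin (ℓ - 1) → K) →ₗ[K] (Fin ℓ → K)) (c' : Fin (ℓ - 1) → K) : ℕ :=
  (A.hyps.filter (fun c => c ≠ c0 ∧ ∃ t : K, t ≠ 0 ∧ restrictForm e c = t • c')).card

/-- The wedge `dx_{i_1} ∧ ⋯ ∧ dx_{i_p}` for a list of indices. -/
def wedgeList (l : List (Fin ℓ)) : ExtF K ℓ :=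
  (l.map (fun i => ExteriorAlgebra.ι (PS K ℓ) (Pi.single i (1 : PS K ℓ)))).prod

/-- A polynomial `p`-form is homogeneous of (coefficient) degree `d` if it is a sum of
terms `f · dx_{i_1} ∧ ⋯ ∧ dx_{i_p}` with `f` homogeneous of degree `d`. -/
def IsHomogForm (p d : ℕ) (η : ExtF K ℓ) : Prop :=
  η ∈ AddSubgroup.closure {ξ : ExtF K ℓ | ∃ (f : PS K ℓ) (l : List (Fin ℓ)),
    f.IsHomogeneous d ∧ l.length = p ∧ ξ = f • wedgeList l}

/-- `|m| = ∑_{H ∈ A} m(H)`. -/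
def msum (A : Arrangement K ℓ) (m : (Fin ℓ → K) → ℕ) : ℕ := ∑ c ∈ A.hyps, m c

/-- The multiarrangement `(A,m)` is free with exponents `(d_1, …, d_ℓ)`: the polynomial
model of `Ω^1(A,m)` has a homogeneous basis whose `i`-th member has coefficient degree
`|m| - d_i`. -/
def FreeWithExp (A : Arrangement K ℓ) (m : (Fin ℓ → K) → ℕ) (d : Fin ℓ → ℕ) : Prop :=
  ∃ b : Fin ℓ → ExtF K ℓ,
    (∀ i, b i ∈ Omega A m 1) ∧
    (∀ i, IsHomogForm 1 (msum A m - d i) (b i)) ∧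
    LinearIndependent (PS K ℓ) b ∧
    Omega A m 1 ≤ Submodule.span (PS K ℓ) (Set.range b)

/-- The exponent vector `(d_1, d_2, 0, …, 0)`. -/
def expVec (d1 d2 : ℕ) : Fin ℓ → ℕ := fun i =>
  if (i : ℕ) = 0 then d1 else if (i : ℕ) = 1 then d2 else 0

/-- The localization `A_X` of `A` at the lattice element `X = H ∩ L` corresponding,
via the identification `e` of `H` with `K^{ℓ-1}`, to the hyperplane of `H`
with coefficient vector `c'`. -/
def locOnRestr (A : Arrangement K ℓ) (e : (Fin (ℓ - 1) → K) →ₗ[K] (Fin ℓ → K))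
    (c' : Fin (ℓ - 1) → K) : Arrangement K ℓ where
  hyps := A.hyps.filter (fun c => ∃ t : K, restrictForm e c = t • c')
  ne_zero := fun c hc => A.ne_zero c (Finset.mem_filter.mp hc).1
  nonprop := fun c hc c'' hc'' =>
    A.nonprop c (Finset.mem_filter.mp hc).1 c'' (Finset.mem_filter.mp hc'').1

/-- The multiplicity `m - δ_H`. -/
def mdel (m : (Fin ℓ → K) → ℕ) (c0 : Fin ℓ → K) : (Fin ℓ → K) → ℕ :=
  fun c => if c = c0 then m c - 1 else m c

/-- `ms` is the Euler multiplicity `m^*` on the restriction `B = A^H` (presented via the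
identification `e`): for each `X ∈ A^H` the rank-two localization `(A_X, m_X)` is free
with exponents `(d_1^X, d_2^X, 0, …, 0)` ordered so that `(A_X, m_X - δ_H)` is free with
exponents `(d_1^X - 1, d_2^X, 0, …, 0)`, and `m^*(X) = d_2^X`. -/
def IsEulerMult (A : Arrangement K ℓ) (m : (Fin ℓ → K) → ℕ) (c0 : Fin ℓ → K)
    (e : (Fin (ℓ - 1) → K) →ₗ[K] (Fin ℓ → K)) (B : Arrangement K (ℓ - 1))
    (ms : (Fin (ℓ - 1) → K) → ℕ) : Prop :=
  ∀ c' ∈ B.hyps, ∃ d1 d2 : ℕ,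
    FreeWithExp (locOnRestr A e c') m (expVec d1 d2) ∧
    FreeWithExp (locOnRestr A e c') (mdel m c0) (expVec (d1 - 1) d2) ∧
    ms c' = d2

/-- An arrangement is generic if any `k ≤ ℓ-1` of its hyperplanes intersect in
codimension `k`, i.e. any `≤ ℓ-1` of its defining forms are linearly independent. -/
def GenericArr (A : Arrangement K ℓ) : Prop :=
  ∀ s : Finset (Fin ℓ → K), s ⊆ A.hyps → s.card ≤ ℓ - 1 →
    LinearIndependent K (fun x : {c // c ∈ s} => (x : Fin ℓ → K))

/-- An arrangement is irreducible if it is not a product of two lower-dimensional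
arrangements, i.e. its defining forms cannot be split into two complementary proper
subspaces of the dual space. -/
def IrreducibleArr (A : Arrangement K ℓ) : Prop :=
  ¬ ∃ U1 U2 : Submodule K (Fin ℓ → K), U1 ≠ ⊥ ∧ U2 ≠ ⊥ ∧ U1 ⊓ U2 = ⊥ ∧ U1 ⊔ U2 = ⊤ ∧
      ∀ c ∈ A.hyps, c ∈ U1 ∨ c ∈ U2

/-- The defining polynomial `Q(A,m) = ∏_{H ∈ A} α_H^{m(H)}`. -/
def Qpoly (A : Arrangement K ℓ) (m : (Fin ℓ → K) → ℕ) : PS K ℓ :=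
  ∏ c ∈ A.hyps, linP c ^ m c

section Homological

open CategoryTheory CategoryTheory.Abelian

variable {R : Type} [CommRing R] {M N Q : Type} [AddCommGroup M] [Module R M]
  [AddCommGroup N] [Module R N] [AddCommGroup Q] [Module R Q]

theorem shortExact_of_exact (f : M →ₗ[R] N) (g : N →ₗ[R] Q) (hf : Function.Injective f)
    (hfg : Function.Exact f g) (hg : Function.Surjective g) :
    (ModuleCat.shortComplexOfCompEqZero f g hfg.linearMap_comp_eq_zero).ShortExact :=
  ModuleCat.shortComplex_shortExact _ hfg hf hg

theorem pdLE_iff (n : ℕ) (M : Type) [AddCommGroup M] [Module R M] :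
    pdLE R n M ↔ HasProjectiveDimensionLT (ModuleCat.of R M) (n + 1) := by
  induction n generalizing M with
  | zero =>
    rw [zero_add, ← projective_iff_hasProjectiveDimensionLT_one, ← IsProjective.iff_projective]
    rfl
  | succ n ih =>
    have key : ∀ (ι : Type) (f : (ι →₀ R) →ₗ[R] M), Function.Surjective f →
        (HasProjectiveDimensionLT (ModuleCat.of R M) (n + 1 + 1) ↔
          HasProjectiveDimensionLT (ModuleCat.of R (LinearMap.ker f)) (n + 1)) := by
      intro ι f hf
      have : Projective (ModuleCat.of R (ι →₀ R)) :=
        (IsProjective.iff_projective _).mp inferInstance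
      exact (LinearMap.shortExact_shortComplexKer hf).hasProjectiveDimensionLT_X₃_iff n this
    constructor
    · rintro ⟨ι, f, hf, h⟩
      exact (key ι f hf).2 ((ih _).1 h)
    · intro h
      refine ⟨M, Finsupp.linearCombination R id, ?_, ?_⟩
      · exact Finsupp.linearCombination_id_surjective R M
      · exact (ih _).2 ((key _ _ (Finsupp.linearCombination_id_surjective R M)).1 h)

theorem pdLE.of_equiv {n : ℕ} (h : pdLE R n M) (e : M ≃ₗ[R] N) : pdLE R n N := by
  rw [pdLE_iff] at h ⊢
  exact hasProjectiveDimensionLT_of_iso (LinearEquiv.toModuleIso e) _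

theorem pdLE.mono {m n : ℕ} (h : pdLE R m M) (hmn : m ≤ n) : pdLE R n M := by
  rw [pdLE_iff] at h ⊢
  exact hasProjectiveDimensionLT_of_ge _ (m + 1) (n + 1) (by lia)

theorem pdLE_of_projective [h : Module.Projective R M] (n : ℕ) : pdLE R n M :=
  pdLE.mono (m := 0) h (Nat.zero_le n)

theorem pdLE_middle {n : ℕ} (f : M →ₗ[R] N) (g : N →ₗ[R] Q) (hf : Function.Injective f)
    (hfg : Function.Exact f g) (hg : Function.Surjective g)
    (h₁ : pdLE R n M) (h₃ : pdLE R n Q) : pdLE R n N := by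
  rw [pdLE_iff] at *
  exact (shortExact_of_exact f g hf hfg hg).hasProjectiveDimensionLT_X₂ _ h₁ h₃

theorem pdLE_right {n : ℕ} (f : M →ₗ[R] N) (g : N →ₗ[R] Q) (hf : Function.Injective f)
    (hfg : Function.Exact f g) (hg : Function.Surjective g)
    (h₁ : pdLE R n M) (h₂ : pdLE R (n + 1) N) : pdLE R (n + 1) Q := by
  rw [pdLE_iff] at *
  exact (shortExact_of_exact f g hf hfg hg).hasProjectiveDimensionLT_X₃ _ h₁ h₂

theorem pdLE_left {n : ℕ} (f : M →ₗ[R] N) (g : N →ₗ[R] Q) (hf : Function.Injective f)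
    (hfg : Function.Exact f g) (hg : Function.Surjective g)
    (h₂ : pdLE R n N) (h₃ : pdLE R (n + 1) Q) : pdLE R n M := by
  rw [pdLE_iff] at *
  exact (shortExact_of_exact f g hf hfg hg).hasProjectiveDimensionLT_X₁ _ h₂ h₃

theorem pdLE.of_retract {n : ℕ} (h : pdLE R n N) (i : M →ₗ[R] N) (r : N →ₗ[R] M)
    (hri : r ∘ₗ i = LinearMap.id) : pdLE R n M := by
  rw [pdLE_iff] at *
  refine Retract.hasProjectiveDimensionLT (Y := ModuleCat.of R N)
    ⟨ModuleCat.ofHom i, ModuleCat.ofHom r, ?_⟩ _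
  rw [← ModuleCat.ofHom_comp, hri]
  rfl

/-- The kernel of a map between projective modules has projective dimension two less than the
cokernel. -/
theorem pdLE_ker {n : ℕ} [Module.Projective R M] [Module.Projective R N] (f : M →ₗ[R] N)
    (h : pdLE R (n + 2) (N ⧸ LinearMap.range f)) : pdLE R n (LinearMap.ker f) := by
  have h1 : pdLE R (n + 1) (LinearMap.range f) :=
    pdLE_left (LinearMap.range f).subtype (LinearMap.range f).mkQ
      (LinearMap.range f).injective_subtype (LinearMap.exact_subtype_mkQ _)
      (Submodule.mkQ_surjective _) (pdLE_of_projective _) h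
  exact pdLE_left (LinearMap.ker f).subtype f.rangeRestrict
    (LinearMap.ker f).injective_subtype
    (by intro x; simp [Subtype.ext_iff]) f.surjective_rangeRestrict (pdLE_of_projective _) h1

/-- Vanishing of `Ext^i(R/P, N)`. -/
def ExtVanish (P : Ideal R) (N : Type) [AddCommGroup N] [Module R N] (i : ℕ) : Prop :=
  ∀ e : Ext (ModuleCat.of R (R ⧸ P)) (ModuleCat.of R N) i, e = 0

theorem ext_smul_eq_zero {P : Ideal R} {r : R} (hr : r ∈ P) {i : ℕ}
    (e : Ext (ModuleCat.of R (R ⧸ P)) (ModuleCat.of R N) i) : r • e = 0 := by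
  have h : r • 𝟙 (ModuleCat.of R (R ⧸ P)) = 0 := by
    ext
    change r • (1 : R ⧸ P) = 0
    change Ideal.Quotient.mk P (r * 1) = 0
    rw [mul_one]
    exact Ideal.Quotient.eq_zero_iff_mem.2 hr
  have : r • e = ((r • Ext.mk₀ (𝟙 (ModuleCat.of R (R ⧸ P))))).comp e (zero_add i) := by
    rw [Ext.smul_comp, Ext.mk₀_id_comp]
  rw [this, ← Ext.mk₀_smul, h, Ext.mk₀_zero, Ext.zero_comp]

theorem extVanish_zero {P : Ideal R} (h : ∀ q : N, (∀ r ∈ P, r • q = 0) → q = 0) :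
    ExtVanish P N 0 := by
  intro e
  obtain ⟨f, rfl⟩ := Ext.mk₀_bijective _ _ |>.2 e
  have : f = 0 := by
    ext
    refine h _ fun r hr => ?_
    change r • f.hom (1 : R ⧸ P) = 0
    rw [← map_smul]
    have : r • (1 : R ⧸ P) = 0 := by
      change Ideal.Quotient.mk P (r * 1) = 0
      rw [mul_one]
      exact Ideal.Quotient.eq_zero_iff_mem.2 hr
    rw [this, map_zero]
  rw [this, Ext.mk₀_zero]

theorem extVanish_of_middle_of_right {P : Ideal R} (f : M →ₗ[R] N) (g : N →ₗ[R] Q)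
    (hf : Function.Injective f) (hfg : Function.Exact f g) (hg : Function.Surjective g) {i : ℕ}
    (h₂ : ExtVanish P N (i + 1)) (h₃ : ExtVanish P Q i) : ExtVanish P M (i + 1) := by
  intro e
  obtain ⟨e', rfl⟩ := Ext.covariant_sequence_exact₁ _ (shortExact_of_exact f g hf hfg hg) e
    (h₂ _) rfl
  rw [h₃ e', Ext.zero_comp]

theorem extVanish_of_left_of_middle {P : Ideal R} (f : M →ₗ[R] N) (g : N →ₗ[R] Q)
    (hf : Function.Injective f) (hfg : Function.Exact f g) (hg : Function.Surjective g) {i : ℕ}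
    (h₁ : ExtVanish P M (i + 1)) (h₂ : ExtVanish P N i) : ExtVanish P Q i := by
  intro e
  obtain ⟨e', rfl⟩ := Ext.covariant_sequence_exact₃ _ (shortExact_of_exact f g hf hfg hg) e
    rfl (h₁ _)
  rw [h₂ e', Ext.zero_comp]

open RingTheory.Sequence Pointwise in
theorem extVanish_of_isWeaklyRegular {P : Ideal R} (rs : List R) (hrs : ∀ r ∈ rs, r ∈ P)
    (hreg : IsWeaklyRegular N rs) (i : ℕ) (hi : i < rs.length) : ExtVanish P N i := by
  induction rs generalizing N i with
  | nil => simp at hi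
  | cons r rs ih =>
    rw [isWeaklyRegular_cons_iff] at hreg
    have hr : r ∈ P := hrs r (by simp)
    cases i with
    | zero =>
      refine extVanish_zero fun q hq => hreg.1 ?_
      simpa using hq r hr
    | succ i =>
      intro e
      have hex := shortExact_of_exact (LinearMap.lsmul R N r) (r • (⊤ : Submodule R N)).mkQ hreg.1
        (LinearMap.exact_lsmul_mkQ_smul_top N r) (Submodule.mkQ_surjective _)
      have h0 : e.comp (Ext.mk₀ (ModuleCat.ofHom (LinearMap.lsmul R N r))) (add_zero (i + 1)) = 0 := by
        have : ModuleCat.ofHom (LinearMap.lsmul R N r) = r • 𝟙 (ModuleCat.of R N) := rfl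
        rw [this, ← Ext.smul_eq_comp_mk₀]
        exact ext_smul_eq_zero hr e
      obtain ⟨e', rfl⟩ := Ext.covariant_sequence_exact₁ _ hex e h0 rfl
      have : e' = 0 := ih (fun r hr => hrs r (by simp [hr])) hreg.2 i (by simpa using hi) e'
      rw [this, Ext.zero_comp]

open RingTheory.Sequence in
theorem isWeaklyRegular_of_flat (rs : List R) (hreg : IsWeaklyRegular R rs)
    [Module.Flat R N] : IsWeaklyRegular N rs := by
  have h := hreg.isWeaklyRegular_rTensor (M₂ := N)
  exact ((TensorProduct.lid R N).isWeaklyRegular_congr rs).1 h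

open RingTheory.Sequence in
theorem extVanish_of_pdLE {P : Ideal R} (rs : List R) (hrs : ∀ r ∈ rs, r ∈ P)
    (hreg : IsWeaklyRegular R rs) (n : ℕ) (hN : pdLE R n N) (i : ℕ) (hi : i + n < rs.length) :
    ExtVanish P N i := by
  induction n generalizing N i with
  | zero =>
    have : Module.Projective R N := hN
    exact extVanish_of_isWeaklyRegular rs hrs (isWeaklyRegular_of_flat rs hreg) i hi
  | succ n ih =>
    obtain ⟨ι, f, hf, h⟩ := hN
    exact extVanish_of_left_of_middle (LinearMap.ker f).subtype f
      (LinearMap.ker f).injective_subtype (LinearMap.exact_subtype_ker_map f) hf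
      (ih h _ (by lia))
      (extVanish_of_isWeaklyRegular rs hrs (isWeaklyRegular_of_flat rs hreg) i (by lia))

/-- If `c` is killed by `P` modulo the image of `g`, then multiplication by `s` moves it into the
image of `g` as soon as the relevant `Ext` groups vanish. -/
theorem smul_mem_range_of_extVanish {M' : Type} [AddCommGroup M'] [Module R M']
    {P : Ideal R} (f : M →ₗ[R] N) (g : N →ₗ[R] Q) (hf : Function.Injective f)
    (hfg : Function.Exact f g)
    (hQ : ∀ q : Q, (∀ r ∈ P, r • q = 0) → q = 0) (hN : ExtVanish P N 1)
    (a : M →ₗ[R] M') (b : M' →ₗ[R] M) (s : R) (hab : ∀ m, b (a m) = s • m)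
    (hM : ExtVanish P M' 2) (c : Q) (hc : ∀ r ∈ P, r • c ∈ LinearMap.range g) :
    s • c ∈ LinearMap.range g := by
  set I := LinearMap.range g
  have hS := shortExact_of_exact f g.rangeRestrict hf
    (by intro x; rw [← hfg x]; simp [Subtype.ext_iff])
    g.surjective_rangeRestrict
  have hT := shortExact_of_exact I.subtype I.mkQ I.injective_subtype
    (LinearMap.exact_subtype_mkQ _) (Submodule.mkQ_surjective _)
  let φ : (R ⧸ P) →ₗ[R] (Q ⧸ I) := P.liftQ (LinearMap.toSpanSingleton R _ (I.mkQ c)) (by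
    intro r hr
    simp only [LinearMap.mem_ker, LinearMap.toSpanSingleton_apply, ← map_smul]
    exact (Submodule.Quotient.mk_eq_zero _).2 (hc r hr))
  have hφ : φ (1 : R ⧸ P) = I.mkQ c := by
    exact (Submodule.liftQ_apply _ _ _).trans (by simp)
  let e0 : Ext (ModuleCat.of R (R ⧸ P)) (ModuleCat.of R (Q ⧸ I)) 0 := Ext.mk₀ (ModuleCat.ofHom φ)
  let e1 : Ext (ModuleCat.of R (R ⧸ P)) (ModuleCat.of R I) 1 := e0.comp hT.extClass rfl
  let e2 : Ext (ModuleCat.of R (R ⧸ P)) (ModuleCat.of R M) 2 := e1.comp hS.extClass rfl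
  have h2 : s • e2 = 0 := by
    rw [Ext.smul_eq_comp_mk₀]
    have : s • 𝟙 (ModuleCat.of R M) = ModuleCat.ofHom a ≫ ModuleCat.ofHom b := by
      ext m
      simp [hab]
    rw [this, ← Ext.mk₀_comp_mk₀, ← Ext.comp_assoc_of_third_deg_zero,
      hM (e2.comp (Ext.mk₀ (ModuleCat.ofHom a)) (add_zero 2)), Ext.zero_comp]
  have h1 : s • e1 = 0 := by
    have : (s • e1).comp hS.extClass rfl = 0 := by rw [Ext.smul_comp]; exact h2
    obtain ⟨x, hx⟩ := Ext.covariant_sequence_exact₃ _ hS (s • e1) rfl this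
    rw [← hx, hN x, Ext.zero_comp]
  have h0 : s • e0 = 0 := by
    have : (s • e0).comp hT.extClass rfl = 0 := by rw [Ext.smul_comp]; exact h1
    obtain ⟨x, hx⟩ := Ext.covariant_sequence_exact₃ _ hT (s • e0) rfl this
    rw [← hx, extVanish_zero hQ x, Ext.zero_comp]
  rw [← Ext.mk₀_smul] at h0
  have h3 : s • ModuleCat.ofHom φ = 0 := (Ext.mk₀_bijective _ _).1 (by rw [h0, Ext.mk₀_zero])
  have h4 : s • φ (1 : R ⧸ P) = 0 := by
    have := congrArg (fun ψ => ψ.hom (1 : R ⧸ P)) h3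
    simpa using this
  rw [hφ, ← map_smul] at h4
  exact (Submodule.Quotient.mk_eq_zero _).1 h4

end Homological

section LinearForms

variable {K : Type} [Field K] {ℓ m n : ℕ}

theorem linP_add (c d : Fin ℓ → K) : linP (c + d) = linP c + linP d := by
  simp [linP, add_mul, Finset.sum_add_distrib]

theorem linP_smul (t : K) (c : Fin ℓ → K) : linP (t • c) = C t * linP c := by
  simp [linP, Finset.mul_sum, mul_assoc]

theorem linP_sub (c d : Fin ℓ → K) : linP (c - d) = linP c - linP d := by
  simp [linP, sub_mul, Finset.sum_sub_distrib]

@[simp] theorem linP_zero : linP (0 : Fin ℓ → K) = 0 := by simp [linP]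

@[simp] theorem linP_single (i : Fin ℓ) : linP (Pi.single i (1 : K)) = X i := by
  rw [linP, Finset.sum_eq_single i] <;> simp +contextual

theorem linP_sum {ι : Type*} (s : Finset ι) (f : ι → Fin ℓ → K) :
    linP (∑ i ∈ s, f i) = ∑ i ∈ s, linP (f i) := by
  induction s using Finset.induction_on with
  | empty => simp
  | insert a s ha ih => rw [Finset.sum_insert ha, Finset.sum_insert ha, linP_add, ih]

theorem linP_injective {c : Fin ℓ → K} (h : linP c = 0) : c = 0 := by
  funext i
  have := congrArg (MvPolynomial.aeval (Pi.single i (1 : K))) h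
  simpa [linP, Pi.single_apply] using this

/-- The substitution of linear forms given by a linear map between spaces of linear forms. -/
def linSubst (T : (Fin ℓ → K) →ₗ[K] (Fin m → K)) : PS K ℓ →ₐ[K] PS K m :=
  aeval fun j => linP (T (Pi.single j 1))

theorem linSubst_C (T : (Fin ℓ → K) →ₗ[K] (Fin m → K)) (t : K) :
    linSubst T (C t) = C t := by
  simp [linSubst, MvPolynomial.algebraMap_eq]

theorem linSubst_X (T : (Fin ℓ → K) →ₗ[K] (Fin m → K)) (j : Fin ℓ) :
    linSubst T (X j) = linP (T (Pi.single j 1)) := by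
  simp [linSubst]

theorem linSubst_linP (T : (Fin ℓ → K) →ₗ[K] (Fin m → K)) (c : Fin ℓ → K) :
    linSubst T (linP c) = linP (T c) := by
  conv_rhs => rw [pi_eq_sum_univ' c]
  rw [map_sum, linP_sum, linP, map_sum]
  refine Finset.sum_congr rfl fun i _ => ?_
  rw [map_smul, linP_smul, map_mul, linSubst_C, linSubst_X]

theorem linSubst_linSubst (T : (Fin ℓ → K) →ₗ[K] (Fin m → K)) (U : (Fin m → K) →ₗ[K] (Fin n → K))
    (f : PS K ℓ) : linSubst U (linSubst T f) = linSubst (U ∘ₗ T) f := by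
  have : (linSubst U).comp (linSubst T) = linSubst (U ∘ₗ T) := by
    ext j
    simp [linSubst_X, linSubst_linP]
  exact DFunLike.congr_fun this f

theorem linSubst_id (f : PS K ℓ) : linSubst LinearMap.id f = f := by
  have : linSubst (LinearMap.id : (Fin ℓ → K) →ₗ[K] _) = AlgHom.id K _ := by
    ext j
    simp [linSubst_X]
  exact DFunLike.congr_fun this f

theorem sub_linSubst_mem (T : (Fin ℓ → K) →ₗ[K] (Fin ℓ → K)) {I : Ideal (PS K ℓ)}
    (hI : ∀ c, linP (c - T c) ∈ I) (f : PS K ℓ) : f - linSubst T f ∈ I := by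
  induction f using MvPolynomial.induction_on with
  | C a => simp
  | add p q hp hq =>
    rw [map_add, add_sub_add_comm]
    exact I.add_mem hp hq
  | mul_X p i hp =>
    have h := hI (Pi.single i 1)
    rw [linP_sub, linP_single] at h
    rw [map_mul, linSubst_X]
    have : p * X i - linSubst T p * linP (T (Pi.single i 1)) =
      (p - linSubst T p) * X i + linSubst T p * (X i - linP (T (Pi.single i 1))) := by ring
    rw [this]
    exact I.add_mem (I.mul_mem_right _ hp) (I.mul_mem_left _ h)

/-- The ideal generated by a space of linear forms. -/
def linIdeal (U : Submodule K (Fin ℓ → K)) : Ideal (PS K ℓ) :=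
  Ideal.span (linP '' (U : Set (Fin ℓ → K)))

theorem ker_linSubst (T : (Fin ℓ → K) →ₗ[K] (Fin m → K)) (σ : (Fin m → K) →ₗ[K] (Fin ℓ → K))
    (hσ : ∀ c, T (σ (T c)) = T c) (f : PS K ℓ) :
    linSubst T f = 0 ↔ f ∈ linIdeal (LinearMap.ker T) := by
  constructor
  · intro h
    have := sub_linSubst_mem (σ ∘ₗ T) (I := linIdeal (LinearMap.ker T)) (fun c =>
      Ideal.subset_span ⟨_, by simp [hσ], rfl⟩) f
    rwa [← linSubst_linSubst, h, map_zero, sub_zero] at this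
  · intro h
    have : linIdeal (LinearMap.ker T) ≤ RingHom.ker (linSubst T) := by
      refine Ideal.span_le.2 ?_
      rintro _ ⟨c, hc, rfl⟩
      have hc' : T c = 0 := hc
      simp [RingHom.mem_ker, linSubst_linP, hc']
    exact this h

theorem exists_projection (U : Submodule K (Fin ℓ → K)) :
    ∃ T : (Fin ℓ → K) →ₗ[K] (Fin ℓ → K), (∀ c, T (T c) = T c) ∧ LinearMap.ker T = U := by
  obtain ⟨W, hW⟩ := U.exists_isCompl
  refine ⟨W.subtype ∘ₗ W.projectionOnto U hW.symm, ?_, ?_⟩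
  · intro c
    simp
  · rw [LinearMap.ker_comp_of_ker_eq_bot _ W.ker_subtype]
    simp

theorem linIdeal_isPrime (U : Submodule K (Fin ℓ → K)) : (linIdeal U).IsPrime := by
  obtain ⟨T, hT, rfl⟩ := exists_projection U
  have : linIdeal (LinearMap.ker T) = RingHom.ker (linSubst T) := by
    ext f
    rw [RingHom.mem_ker, ker_linSubst T LinearMap.id (by simpa using hT)]
  rw [this]
  exact RingHom.ker_isPrime _

theorem linP_mem_linIdeal (U : Submodule K (Fin ℓ → K)) (c : Fin ℓ → K) :
    linP c ∈ linIdeal U ↔ c ∈ U := by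
  obtain ⟨T, hT, rfl⟩ := exists_projection U
  rw [← ker_linSubst T LinearMap.id (by simpa using hT), linSubst_linP]
  exact ⟨fun h => linP_injective h, fun h => by rw [LinearMap.mem_ker.1 h, linP_zero]⟩

theorem linIdeal_span (s : Set (Fin ℓ → K)) :
    linIdeal (Submodule.span K s) = Ideal.span (linP '' s) := by
  refine le_antisymm (Ideal.span_le.2 ?_) (Ideal.span_mono (Set.image_mono Submodule.subset_span))
  rintro _ ⟨c, hc, rfl⟩
  induction hc using Submodule.span_induction with
  | mem c hc => exact Ideal.subset_span ⟨c, hc, rfl⟩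
  | zero => simp
  | add c d _ _ h1 h2 => rw [linP_add]; exact Ideal.add_mem _ h1 h2
  | smul t c _ h => rw [linP_smul]; exact Ideal.mul_mem_left _ _ h

theorem linIdeal_span_singleton (c : Fin ℓ → K) :
    linIdeal (Submodule.span K {c}) = Ideal.span {linP c} := by
  rw [linIdeal_span, Set.image_singleton]

theorem linP_prime {c : Fin ℓ → K} (hc : c ≠ 0) : Prime (linP c) := by
  rw [← Ideal.span_singleton_prime fun h => hc (linP_injective h), ← linIdeal_span_singleton]
  exact linIdeal_isPrime _

theorem linP_dvd_iff (c d : Fin ℓ → K) : linP c ∣ linP d ↔ ∃ t : K, t • c = d := by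
  rw [← Ideal.mem_span_singleton, ← linIdeal_span_singleton, linP_mem_linIdeal,
    Submodule.mem_span_singleton]

open RingTheory.Sequence in
/-- Linearly independent linear forms form a regular sequence. -/
theorem isWeaklyRegular_linP (cs : List (Fin ℓ → K))
    (h : ∀ (i : ℕ) (hi : i < cs.length), cs[i] ∉ Submodule.span K {c | c ∈ cs.take i}) :
    IsWeaklyRegular (PS K ℓ) (cs.map linP) := by
  rw [isWeaklyRegular_iff]
  intro i hi
  have hi' : i < cs.length := by simpa using hi
  have hI : (Ideal.ofList ((cs.map linP).take i) • ⊤ : Ideal (PS K ℓ)) =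
      linIdeal (Submodule.span K {c | c ∈ cs.take i}) := by
    rw [linIdeal_span, smul_eq_mul, Ideal.mul_top, Ideal.ofList, ← List.map_take]
    congr 1
    ext f
    simp [-List.map_take]
  have hp := linIdeal_isPrime (Submodule.span K {c | c ∈ cs.take i})
  have hn := mt (linP_mem_linIdeal _ _).1 (h i hi')
  rw [hI, List.getElem_map]
  rw [isSMulRegular_iff_right_eq_zero_of_smul]
  intro q hq
  obtain ⟨f, rfl⟩ := Submodule.Quotient.mk_surjective _ q
  rw [← Submodule.Quotient.mk_smul, Submodule.Quotient.mk_eq_zero] at hq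
  exact (Submodule.Quotient.mk_eq_zero _).2 ((hp.mem_or_mem hq).resolve_left hn)

end LinearForms

section FreeDivisibility

variable {R E : Type*} [CommRing R] [AddCommGroup E] [Module R E]

theorem exteriorAlgebra_free [Module.Free R E] : Module.Free R (ExteriorAlgebra R E) := by
  let : LinearOrder (Module.Free.ChooseBasisIndex R E) := IsWellOrder.linearOrder WellOrderingRel
  exact Module.Free.of_basis (Module.Free.chooseBasis R E).ExteriorAlgebra

theorem exists_smul_of_smul_eq [IsDomain R] [Module.Free R E] {α s : R} (hα : Prime α)
    (hs : ¬ α ∣ s) {η ξ : E} (h : s • η = α • ξ) : ∃ ζ, η = α • ζ := by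
  let b := Module.Free.chooseBasis R E
  have hd : ∀ i, ∃ g, b.repr η i = α * g := by
    intro i
    have : s * b.repr η i = α * b.repr ξ i := by
      have := DFunLike.congr_fun (congrArg b.repr h) i
      simpa using this
    exact (hα.dvd_or_dvd (Dvd.intro _ this.symm)).resolve_left hs
  choose g hg using hd
  refine ⟨b.repr.symm (Finsupp.onFinset (b.repr η).support g fun i hi => ?_), ?_⟩
  · simp only [Finsupp.mem_support_iff, hg i]
    exact mul_ne_zero hα.ne_zero hi
  · apply b.repr.injective
    ext i
    simp [hg i]

theorem exists_prod_smul_eq [IsDomain R] [Module.Free R E] {ι : Type*} (s : Finset ι) (f : ι → R)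
    (hf : ∀ i ∈ s, Prime (f i)) (hne : ∀ i ∈ s, ∀ j ∈ s, i ≠ j → ¬ f i ∣ f j) {η : E}
    (h : ∀ i ∈ s, ∃ ξ, η = f i • ξ) : ∃ ξ, η = (∏ i ∈ s, f i) • ξ := by
  induction s using Finset.induction_on with
  | empty => exact ⟨η, by simp⟩
  | insert a s ha ih =>
    obtain ⟨ξ, rfl⟩ := ih (fun i hi => hf i (Finset.mem_insert_of_mem hi))
      (fun i hi j hj => hne i (Finset.mem_insert_of_mem hi) j (Finset.mem_insert_of_mem hj))
      (fun i hi => h i (Finset.mem_insert_of_mem hi))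
    obtain ⟨ξ', hξ'⟩ := h a (Finset.mem_insert_self _ _)
    have hpa := hf a (Finset.mem_insert_self _ _)
    have hna : ¬ f a ∣ ∏ i ∈ s, f i := by
      rw [Prime.dvd_finsetProd_iff hpa]
      rintro ⟨i, hi, hdvd⟩
      exact hne a (Finset.mem_insert_self _ _) i (Finset.mem_insert_of_mem hi)
        (fun h => ha (h ▸ hi)) hdvd
    obtain ⟨ζ, rfl⟩ := exists_smul_of_smul_eq hpa hna hξ'
    exact ⟨ζ, by rw [Finset.prod_insert ha, smul_smul, mul_comm]⟩

end FreeDivisibility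

section Forms

variable {K : Type} [Field K] {ℓ m n : ℕ}

instance extF_free : Module.Free (PS K ℓ) (ExtF K ℓ) := exteriorAlgebra_free

instance formsP_free (p : ℕ) : Module.Free (PS K ℓ) (formsP K ℓ p) :=
  inferInstanceAs (Module.Free (PS K ℓ) (⋀[PS K ℓ]^p (Fin ℓ → PS K ℓ)))

theorem dP_add (c d : Fin ℓ → K) : dP (c + d) = dP c + dP d := by
  rw [dP, dP, dP, ← map_add]
  congr 1
  ext1 i
  simp

theorem dP_smul (t : K) (c : Fin ℓ → K) : dP (t • c) = (C t : PS K ℓ) • dP c := by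
  rw [dP, dP, ← map_smul]
  congr 1
  ext1 i
  simp

@[simp] theorem dP_zero : dP (0 : Fin ℓ → K) = 0 := by
  simpa using dP_smul 0 (0 : Fin ℓ → K)

theorem dP_mul_self (c : Fin ℓ → K) : dP c * dP c = 0 := ExteriorAlgebra.ι_sq_zero _

theorem dP_mul_comm (c d : Fin ℓ → K) : dP c * dP d = - (dP d * dP c) :=
  eq_neg_of_add_eq_zero_left (ExteriorAlgebra.ι_add_mul_swap _ _)

theorem dP_mul_dP_mul_self (c : Fin ℓ → K) (η : ExtF K ℓ) : dP c * (dP c * η) = 0 := by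
  rw [← mul_assoc, dP_mul_self, zero_mul]

theorem dP_mul_dP_mul_comm (c d : Fin ℓ → K) (η : ExtF K ℓ) :
    dP c * (dP d * η) = - (dP d * (dP c * η)) := by
  rw [← mul_assoc, dP_mul_comm, neg_mul, mul_assoc]

theorem ι_eq_sum_dP (u : Fin ℓ → PS K ℓ) :
    ExteriorAlgebra.ι (PS K ℓ) u = ∑ j, u j • dP (Pi.single j (1 : K)) := by
  conv_lhs => rw [pi_eq_sum_univ' u]
  rw [map_sum]
  refine Finset.sum_congr rfl fun j _ => ?_
  rw [map_smul, dP]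
  congr 2
  ext1 i
  by_cases h : j = i <;> simp [h, eq_comm]

/-- Induction principle for polynomial differential forms. -/
theorem extF_induction {P : ExtF K ℓ → Prop} (one : P 1) (add : ∀ x y, P x → P y → P (x + y))
    (smul : ∀ (f : PS K ℓ) x, P x → P (f • x))
    (dP_mul : ∀ j x, P x → P (dP (Pi.single j (1 : K)) * x)) (x : ExtF K ℓ) : P x := by
  have zero : P 0 := by simpa using smul 0 1 one
  induction x using CliffordAlgebra.left_induction with
  | algebraMap r => rw [Algebra.algebraMap_eq_smul_one]; exact smul _ _ one
  | add x y hx hy => exact add x y hx hy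
  | ι_mul x u hx =>
    change P (ExteriorAlgebra.ι (PS K ℓ) u * x)
    rw [ι_eq_sum_dP, Finset.sum_mul]
    refine Finset.sum_induction _ P add zero fun j _ => ?_
    rw [smul_mul_assoc]
    exact smul _ _ (dP_mul _ _ hx)

theorem dP_mul_mem (c : Fin ℓ → K) {p : ℕ} {η : ExtF K ℓ} (h : η ∈ formsP K ℓ p) :
    dP c * η ∈ formsP K ℓ (p + 1) := by
  rw [formsP, pow_succ']
  exact Submodule.mul_mem_mul ⟨_, rfl⟩ h

theorem formsP_induction {P : ℕ → ExtF K ℓ → Prop} (one : P 0 1)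
    (add : ∀ p x y, P p x → P p y → P p (x + y)) (smul : ∀ p (f : PS K ℓ) x, P p x → P p (f • x))
    (dP_mul : ∀ p j x, x ∈ formsP K ℓ p → P p x → P (p + 1) (dP (Pi.single j (1 : K)) * x))
    (zero : ∀ p, P p 0)
    (p : ℕ) (x : ExtF K ℓ) (hx : x ∈ formsP K ℓ p) : P p x := by
  induction p generalizing x with
  | zero =>
    rw [formsP, pow_zero, Submodule.mem_one] at hx
    obtain ⟨r, rfl⟩ := hx
    rw [Algebra.algebraMap_eq_smul_one]; exact smul _ _ _ one
  | succ p ih =>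
    rw [formsP, pow_succ'] at hx
    induction hx using Submodule.mul_induction_on' with
    | mem_mul_mem u hu x hx =>
      obtain ⟨u, rfl⟩ := hu
      rw [ι_eq_sum_dP, Finset.sum_mul]
      refine Finset.sum_induction _ _ (add _) (zero _) fun j _ => ?_
      rw [smul_mul_assoc]
      exact smul _ _ _ (dP_mul _ _ _ hx (ih x hx))
    | add x _ y _ hx hy => exact add _ _ _ hx hy

/-- The projection to the degree `p` component. -/
def formsProj (K : Type) [Field K] (ℓ p : ℕ) : ExtF K ℓ →ₗ[PS K ℓ] ExtF K ℓ :=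
  GradedAlgebra.proj (fun i => ⋀[PS K ℓ]^i (Fin ℓ → PS K ℓ)) p

theorem formsProj_mem (p : ℕ) (η : ExtF K ℓ) : formsProj K ℓ p η ∈ formsP K ℓ p :=
  SetLike.coe_mem (DirectSum.decompose (fun i => ⋀[PS K ℓ]^i (Fin ℓ → PS K ℓ)) η p)

theorem formsProj_of_mem {p : ℕ} {η : ExtF K ℓ} (h : η ∈ formsP K ℓ p) :
    formsProj K ℓ p η = η :=
  DirectSum.decompose_of_mem_same (fun i => ⋀[PS K ℓ]^i (Fin ℓ → PS K ℓ)) h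

theorem mem_formsP_of_smul_mem {f : PS K ℓ} (hf : f ≠ 0) {p : ℕ} {η : ExtF K ℓ}
    (h : f • η ∈ formsP K ℓ p) : η ∈ formsP K ℓ p := by
  have h1 := formsProj_of_mem h
  rw [map_smul] at h1
  rw [← smul_right_injective _ hf h1]
  exact formsProj_mem _ _

/-- The contraction with a constant vector field. -/
def contr (v : Fin ℓ → K) : ExtF K ℓ →ₗ[PS K ℓ] ExtF K ℓ :=
  CliffordAlgebra.contractLeft (Q := (0 : QuadraticForm (PS K ℓ) (Fin ℓ → PS K ℓ)))
    (∑ j, (C (v j) : PS K ℓ) • LinearMap.proj j)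

theorem contr_dP_mul (v c : Fin ℓ → K) (η : ExtF K ℓ) :
    contr v (dP c * η) = (C (∑ i, c i * v i) : PS K ℓ) • η - dP c * contr v η := by
  refine (CliffordAlgebra.contractLeft_ι_mul _ _ _).trans ?_
  congr 2
  simp [mul_comm]

@[simp] theorem contr_one (v : Fin ℓ → K) : contr v 1 = 0 :=
  CliffordAlgebra.contractLeft_one _ _

theorem contr_mem_aux (v : Fin ℓ → K) (p : ℕ) (η : ExtF K ℓ) (h : η ∈ formsP K ℓ p) :
    (p = 0 → contr v η = 0) ∧ contr v η ∈ formsP K ℓ (p - 1) := by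
  refine formsP_induction (P := fun p η => (p = 0 → contr v η = 0) ∧
    contr v η ∈ formsP K ℓ (p - 1)) ?_ ?_ ?_ ?_ ?_ p η h
  · simp
  · intro p x y hx hy
    rw [map_add]
    exact ⟨fun h => by rw [hx.1 h, hy.1 h, add_zero], add_mem hx.2 hy.2⟩
  · intro p f x hx
    rw [map_smul]
    exact ⟨fun h => by rw [hx.1 h, smul_zero], Submodule.smul_mem _ _ hx.2⟩
  · intro p j x hx h
    refine ⟨by simp, ?_⟩
    rw [contr_dP_mul]
    refine sub_mem (Submodule.smul_mem _ _ hx) ?_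
    rcases p with _ | p
    · simp [h.1 rfl]
    · exact dP_mul_mem _ h.2
  · simp

theorem contr_eq_zero (v : Fin ℓ → K) {η : ExtF K ℓ} (h : η ∈ formsP K ℓ 0) : contr v η = 0 :=
  (contr_mem_aux v 0 η h).1 rfl

theorem contr_mem (v : Fin ℓ → K) {p : ℕ} {η : ExtF K ℓ} (h : η ∈ formsP K ℓ p) :
    contr v η ∈ formsP K ℓ (p - 1) :=
  (contr_mem_aux v p η h).2

end Forms

section SemilinearMap

variable {R R' M M' : Type*} [CommRing R] [CommRing R'] [AddCommGroup M] [AddCommGroup M']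
  [Module R M] [Module R' M']

/-- The map of exterior algebras induced by a semilinear map. -/
def exteriorSemiMap (φ : R →+* R') (f : M →ₛₗ[φ] M') :
    ExteriorAlgebra R M →+* ExteriorAlgebra R' M' :=
  letI : Algebra R (ExteriorAlgebra R' M') := Algebra.compHom _ φ
  (ExteriorAlgebra.lift R (A := ExteriorAlgebra R' M')
    ⟨{ toFun := fun u => ExteriorAlgebra.ι R' (f u)
       map_add' := fun u v => by rw [map_add, map_add]
       map_smul' := fun r u => by
        rw [map_smulₛₗ, map_smul]
        rfl }, fun u => ExteriorAlgebra.ι_sq_zero _⟩).toRingHom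

theorem exteriorSemiMap_ι (φ : R →+* R') (f : M →ₛₗ[φ] M') (u : M) :
    exteriorSemiMap φ f (ExteriorAlgebra.ι R u) = ExteriorAlgebra.ι R' (f u) :=
  letI : Algebra R (ExteriorAlgebra R' M') := Algebra.compHom _ φ
  ExteriorAlgebra.lift_ι_apply (A := ExteriorAlgebra R' M') R _ _ u

theorem exteriorSemiMap_smul (φ : R →+* R') (f : M →ₛₗ[φ] M') (r : R) (η : ExteriorAlgebra R M) :
    exteriorSemiMap φ f (r • η) = φ r • exteriorSemiMap φ f η := by
  let : Algebra R (ExteriorAlgebra R' M') := Algebra.compHom _ φ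
  exact map_smul (ExteriorAlgebra.lift R (A := ExteriorAlgebra R' M') _) r η

end SemilinearMap

section Pullback

variable {K : Type} [Field K] {ℓ m n : ℕ}

/-- The map of polynomial differential forms induced by a linear map between spaces of linear
forms. -/
def pullF (T : (Fin ℓ → K) →ₗ[K] (Fin m → K)) : ExtF K ℓ →+* ExtF K m :=
  exteriorSemiMap (linSubst T : PS K ℓ →+* PS K m)
    { toFun := fun u i => ∑ j, linSubst T (u j) * C (T (Pi.single j 1) i)
      map_add' := fun u v => by
        ext1 i
        simp [add_mul, Finset.sum_add_distrib]
      map_smul' := fun r u => by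
        ext1 i
        simp [Finset.mul_sum, mul_assoc] }

theorem pullF_smul (T : (Fin ℓ → K) →ₗ[K] (Fin m → K)) (f : PS K ℓ) (η : ExtF K ℓ) :
    pullF T (f • η) = linSubst T f • pullF T η :=
  exteriorSemiMap_smul _ _ _ _

theorem pullF_dP (T : (Fin ℓ → K) →ₗ[K] (Fin m → K)) (c : Fin ℓ → K) :
    pullF T (dP c) = dP (T c) := by
  refine (exteriorSemiMap_ι _ _ _).trans ?_
  rw [dP]
  congr 1
  ext1 i
  have : T c i = ∑ j, c j * T (Pi.single j 1) i := by
    conv_lhs => rw [pi_eq_sum_univ' c]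
    simp
  rw [this]
  simp

theorem pullF_pullF (T : (Fin ℓ → K) →ₗ[K] (Fin m → K)) (U : (Fin m → K) →ₗ[K] (Fin n → K))
    (η : ExtF K ℓ) : pullF U (pullF T η) = pullF (U ∘ₗ T) η := by
  induction η using extF_induction with
  | one => simp
  | add x y hx hy => simp [hx, hy]
  | smul f x hx => rw [pullF_smul, pullF_smul, pullF_smul, hx, linSubst_linSubst]
  | dP_mul j x hx => simp [pullF_dP, hx]

theorem pullF_id (η : ExtF K ℓ) : pullF LinearMap.id η = η := by
  induction η using extF_induction with
  | one => simp
  | add x y hx hy => simp [hx, hy]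
  | smul f x hx => rw [pullF_smul, hx, linSubst_id]
  | dP_mul j x hx => simp [pullF_dP, hx]

theorem pullF_mem (T : (Fin ℓ → K) →ₗ[K] (Fin m → K)) {p : ℕ} {η : ExtF K ℓ}
    (h : η ∈ formsP K ℓ p) : pullF T η ∈ formsP K m p := by
  refine formsP_induction (P := fun p η => pullF T η ∈ formsP K m p) ?_ ?_ ?_ ?_ ?_ p η h
  · simp [formsP]
  · intro p x y hx hy
    rw [map_add]
    exact add_mem hx hy
  · intro p f x hx
    rw [pullF_smul]
    exact Submodule.smul_mem _ _ hx
  · intro p j x _ hx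
    rw [map_mul, pullF_dP]
    exact dP_mul_mem _ hx
  · simp

theorem sub_pullF (T : (Fin ℓ → K) →ₗ[K] (Fin ℓ → K)) (c : Fin ℓ → K)
    (hT : ∀ d, d - T d ∈ Submodule.span K {c}) (η : ExtF K ℓ) :
    ∃ ξ ζ, η - pullF T η = linP c • ξ + dP c * ζ := by
  induction η using extF_induction with
  | one => exact ⟨0, 0, by simp⟩
  | add x y hx hy =>
    obtain ⟨ξ, ζ, h⟩ := hx
    obtain ⟨ξ', ζ', h'⟩ := hy
    refine ⟨ξ + ξ', ζ + ζ', ?_⟩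
    rw [map_add, add_sub_add_comm, h, h', smul_add, mul_add]
    abel
  | smul f x hx =>
    obtain ⟨ξ, ζ, h⟩ := hx
    obtain ⟨g, hg⟩ := Ideal.mem_span_singleton.1 <| sub_linSubst_mem T
      (I := Ideal.span {linP c}) (fun d => by
        rw [← linIdeal_span_singleton, linP_mem_linIdeal]
        exact hT d) f
    refine ⟨g • x + linSubst T f • ξ, linSubst T f • ζ, ?_⟩
    have : f • x - linSubst T f • pullF T x =
      (f - linSubst T f) • x + linSubst T f • (x - pullF T x) := by
      rw [sub_smul, smul_sub]; abel
    rw [pullF_smul, this, hg, h, smul_add, smul_add, mul_smul, mul_smul_comm,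
      smul_comm (linSubst T f) (linP c), add_assoc]
  | dP_mul j x hx =>
    obtain ⟨ξ, ζ, h⟩ := hx
    obtain ⟨t, ht⟩ := Submodule.mem_span_singleton.1 (hT (Pi.single j 1))
    have h1 : dP (Pi.single j (1 : K)) - dP (T (Pi.single j 1)) = (C t : PS K ℓ) • dP c := by
      rw [← dP_smul, ht, sub_eq_add_neg, sub_eq_add_neg, dP_add]
      congr 1
      simpa using (dP_smul (-1) (T (Pi.single j 1))).symm
    refine ⟨dP (Pi.single j (1 : K)) * ξ, (C t : PS K ℓ) • pullF T x - dP (Pi.single j (1 : K)) * ζ, ?_⟩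
    have : dP (Pi.single j (1 : K)) * x - dP (T (Pi.single j 1)) * pullF T x =
      dP (Pi.single j (1 : K)) * (x - pullF T x) +
        (dP (Pi.single j (1 : K)) - dP (T (Pi.single j 1))) * pullF T x := by
      rw [mul_sub, sub_mul]; abel
    rw [map_mul, pullF_dP, this, h, h1, mul_add, mul_sub, dP_mul_dP_mul_comm, mul_smul_comm,
      mul_smul_comm, smul_mul_assoc]
    abel

end Pullback

section RestrictScalars

/-- The module `M` over `R'` viewed as a module over `R` through a ring homomorphism. -/
def ViaHom {R R' : Type} [CommRing R] [CommRing R'] (_ : R →+* R') (M : Type) : Type := M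

namespace ViaHom

variable {R R' : Type} [CommRing R] [CommRing R'] (φ : R →+* R') (M : Type) [AddCommGroup M]
  [Module R' M]

instance : AddCommGroup (ViaHom φ M) := inferInstanceAs (AddCommGroup M)

instance : Module R (ViaHom φ M) := Module.compHom M φ

/-- The identity map. -/
def mk : M ≃+ ViaHom φ M := AddEquiv.refl M

variable {M}

theorem smul_mk (r : R) (x : M) : r • mk φ M x = mk φ M (φ r • x) := rfl

end ViaHom

end RestrictScalars

section LogForms

variable {K : Type} [Field K] {ℓ m : ℕ}

/-- The polynomial model of the logarithmic `p`-forms of a simple arrangement. -/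
abbrev logForms (A : Arrangement K ℓ) (p : ℕ) : Submodule (PS K ℓ) (ExtF K ℓ) :=
  Omega A (fun _ => 1) p

theorem mem_logForms {A : Arrangement K ℓ} {p : ℕ} {η : ExtF K ℓ} :
    η ∈ logForms A p ↔ η ∈ formsP K ℓ p ∧ ∀ c ∈ A.hyps, ∃ ξ, dP c * η = linP c • ξ := by
  simp only [logForms, Omega, Submodule.mem_inf, Submodule.mem_iInf, Submodule.mem_comap,
    Submodule.mem_map, pow_one, LinearMap.mulLeft_apply, LinearMap.lsmul_apply]
  refine and_congr_right fun hη => forall₂_congr fun c hc => ⟨?_, ?_⟩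
  · rintro ⟨ξ, _, h⟩
    exact ⟨ξ, h.symm⟩
  · rintro ⟨ξ, h⟩
    refine ⟨ξ, mem_formsP_of_smul_mem (f := linP c) ?_ (h ▸ dP_mul_mem c hη), h.symm⟩
    exact fun h0 => A.ne_zero c hc (linP_injective h0)

theorem mem_delArr {A : Arrangement K ℓ} {c0 c : Fin ℓ → K} :
    c ∈ (delArr A c0).hyps ↔ c ≠ c0 ∧ c ∈ A.hyps :=
  Finset.mem_erase

theorem linP_not_dvd (A : Arrangement K ℓ) {c d : Fin ℓ → K} (hc : c ∈ A.hyps) (hd : d ∈ A.hyps)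
    (hcd : c ≠ d) : ¬ linP c ∣ linP d := by
  rw [linP_dvd_iff]
  rintro ⟨t, rfl⟩
  exact A.nonprop _ hd _ hc hcd.symm t rfl

/-- The map of linear forms dual to a linear map. -/
def dualL {m n : ℕ} (T : (Fin m → K) →ₗ[K] (Fin n → K)) : (Fin n → K) →ₗ[K] (Fin m → K) where
  toFun c i := ∑ j, c j * T (Pi.single i 1) j
  map_add' c d := by
    ext1 i
    simp [add_mul, Finset.sum_add_distrib]
  map_smul' t c := by
    ext1 i
    simp [Finset.mul_sum, mul_assoc]

theorem sum_dualL {m n : ℕ} (T : (Fin m → K) →ₗ[K] (Fin n → K)) (c : Fin n → K) (y : Fin m → K) :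
    ∑ i, dualL T c i * y i = ∑ j, c j * T y j := by
  have : ∀ j, T y j = ∑ i, y i * T (Pi.single i 1) j := by
    intro j
    conv_lhs => rw [pi_eq_sum_univ' y]
    simp
  simp only [this, dualL, LinearMap.coe_mk, AddHom.coe_mk, Finset.mul_sum, Finset.sum_mul]
  rw [Finset.sum_comm]
  exact Finset.sum_congr rfl fun j _ => Finset.sum_congr rfl fun i _ => by ring

/-- `B` is the restriction of `A` to the hyperplane defined by `c0`, with linear forms restricted
by `π` and extended by `σ`. -/
structure Restriction (A : Arrangement K ℓ) (c0 : Fin ℓ → K) (B : Arrangement K m) where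
  π : (Fin ℓ → K) →ₗ[K] (Fin m → K)
  σ : (Fin m → K) →ₗ[K] (Fin ℓ → K)
  π_σ : π ∘ₗ σ = LinearMap.id
  π_c0 : π c0 = 0
  ker_π : ∀ c, π c = 0 → c ∈ Submodule.span K {c0}
  mem : c0 ∈ A.hyps
  exists_restr : ∀ c ∈ A.hyps, c ≠ c0 → ∃ c' ∈ B.hyps, ∃ t : K, t ≠ 0 ∧ π c = t • c'
  exists_lift : ∀ c' ∈ B.hyps, ∃ c ∈ A.hyps, c ≠ c0 ∧ ∃ t : K, t ≠ 0 ∧ π c = t • c'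

theorem exists_sum_mul_eq_one {c : Fin ℓ → K} (hc : c ≠ 0) : ∃ v : Fin ℓ → K, ∑ i, c i * v i = 1 := by
  obtain ⟨i, hi⟩ := Function.ne_iff.1 hc
  refine ⟨Pi.single i (c i)⁻¹, ?_⟩
  rw [Finset.sum_eq_single i]
  · simpa using mul_inv_cancel₀ hi
  · intro j _ hj
    simp [hj]
  · simp

theorem exists_restriction {A : Arrangement K ℓ} {c0 : Fin ℓ → K} (hc0 : c0 ∈ A.hyps)
    {e : (Fin (ℓ - 1) → K) →ₗ[K] (Fin ℓ → K)} {B : Arrangement K (ℓ - 1)}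
    (he : IsHypEmbedding c0 e) (hB : IsRestrictionOf B A c0 e) :
    Nonempty (Restriction A c0 B) := by
  obtain ⟨r, hr⟩ := e.exists_leftInverse_of_injective (LinearMap.ker_eq_bot.2 he.1)
  have hdot : ∀ c v : Fin ℓ → K, dotLin c v = ∑ i, c i * v i := by
    intro c v
    simp [dotLin]
  have hmem : ∀ v : Fin ℓ → K, v ∈ LinearMap.range e ↔ ∑ i, c0 i * v i = 0 := by
    intro v
    rw [he.2, LinearMap.mem_ker, hdot]
  have hext : ∀ {n : ℕ} (c d : Fin n → K), (∀ v : Fin n → K, ∑ i, c i * v i = ∑ i, d i * v i) → c = d := by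
    intro n c d h
    ext i
    simpa [Pi.single_apply] using h (Pi.single i 1)
  refine ⟨⟨dualL e, dualL r, ?_, ?_, ?_, hc0, hB.1, hB.2⟩⟩
  · refine LinearMap.ext fun c => hext _ _ fun v => ?_
    rw [LinearMap.comp_apply, sum_dualL, sum_dualL, ← LinearMap.comp_apply r e v, hr]
    rfl
  · refine hext _ _ fun v => ?_
    rw [sum_dualL, (hmem (e v)).1 ⟨v, rfl⟩]
    simp
  · intro c hc
    obtain ⟨v, hv⟩ := exists_sum_mul_eq_one (A.ne_zero c0 hc0)
    refine Submodule.mem_span_singleton.2 ⟨∑ i, c i * v i, hext _ _ fun w => ?_⟩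
    obtain ⟨y, hy⟩ := (hmem (w - (∑ i, c0 i * w i) • v)).2 (by
      simp only [Pi.sub_apply, Pi.smul_apply, smul_eq_mul, mul_sub, Finset.sum_sub_distrib]
      simp only [mul_left_comm (c0 _), ← Finset.mul_sum, hv, mul_one, sub_self])
    have h0 := sum_dualL e c y
    rw [hc, hy] at h0
    simp only [Pi.sub_apply, Pi.smul_apply, smul_eq_mul, mul_sub, Finset.sum_sub_distrib,
      Pi.zero_apply, zero_mul, Finset.sum_const_zero, mul_left_comm (c _), ← Finset.mul_sum] at h0
    simp only [Pi.smul_apply, smul_eq_mul, mul_assoc, ← Finset.mul_sum]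
    rw [mul_comm]
    exact (sub_eq_zero.1 h0.symm).symm

/-- Multiplication by the linear form of the deleted hyperplane. -/
def mulForm (A : Arrangement K ℓ) (c0 : Fin ℓ → K) (p : ℕ) : logForms (delArr A c0) p →ₗ[PS K ℓ] logForms A p :=
  ((LinearMap.lsmul (PS K ℓ) (ExtF K ℓ) (linP c0)).comp (Submodule.subtype _)).codRestrict _ (by
    rintro ⟨η, hη⟩
    rw [mem_logForms] at hη ⊢
    refine ⟨Submodule.smul_mem _ _ hη.1, fun c hc => ?_⟩
    simp only [LinearMap.comp_apply, Submodule.subtype_apply, LinearMap.lsmul_apply, mul_smul_comm]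
    by_cases h : c = c0
    · rw [h]
      exact ⟨_, rfl⟩
    · obtain ⟨ξ, hξ⟩ := hη.2 c (mem_delArr.2 ⟨h, hc⟩)
      exact ⟨linP c0 • ξ, by rw [hξ, smul_comm]⟩)

theorem coe_mulForm {A : Arrangement K ℓ} {c0 : Fin ℓ → K} {p : ℕ} (η : logForms (delArr A c0) p) :
    (mulForm A c0 p η : ExtF K ℓ) = linP c0 • (η : ExtF K ℓ) := rfl

namespace Restriction

variable {A : Arrangement K ℓ} {c0 : Fin ℓ → K} {B : Arrangement K m} (D : Restriction A c0 B)
  {v : Fin ℓ → K} (hv : ∑ i, c0 i * v i = 1) {p : ℕ} {η : ExtF K ℓ}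

theorem ne_zero (D : Restriction A c0 B) : c0 ≠ 0 := A.ne_zero _ D.mem

theorem π_apply_σ (c : Fin m → K) : D.π (D.σ c) = c := LinearMap.congr_fun D.π_σ c

theorem pullF_σ (η : ExtF K m) : pullF D.π (pullF D.σ η) = η := by
  rw [pullF_pullF, D.π_σ, pullF_id]

theorem linSubst_σ (f : PS K m) : linSubst D.π (linSubst D.σ f) = f := by
  rw [linSubst_linSubst, D.π_σ, linSubst_id]

theorem linSubst_eq_zero {f : PS K ℓ} : linSubst D.π f = 0 ↔ linP c0 ∣ f := by
  rw [ker_linSubst D.π D.σ (fun c => D.π_apply_σ _), ← Ideal.mem_span_singleton,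
    ← linIdeal_span_singleton]
  have : LinearMap.ker D.π = Submodule.span K {c0} := by
    refine le_antisymm (fun c hc => D.ker_π c hc) ?_
    rw [Submodule.span_singleton_le_iff_mem]
    exact D.π_c0
  rw [this]

theorem exists_of_pullF_eq_zero (h : pullF D.π η = 0) :
    ∃ ξ ζ, η = linP c0 • ξ + dP c0 * ζ := by
  obtain ⟨ξ, ζ, h'⟩ := sub_pullF (D.σ ∘ₗ D.π) c0 (fun d => D.ker_π _ (by
    simp [D.π_apply_σ])) η
  rw [← pullF_pullF, h, map_zero, sub_zero] at h'
  exact ⟨ξ, ζ, h'⟩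

theorem pullF_linP_c0_smul : pullF D.π (linP c0 • η) = 0 := by
  rw [pullF_smul, linSubst_linP, D.π_c0, linP_zero, zero_smul]

theorem pullF_dP_c0_mul : pullF D.π (dP c0 * η) = 0 := by
  rw [map_mul, pullF_dP, D.π_c0, dP_zero, zero_mul]

theorem contr_decomp (hv : ∑ i, c0 i * v i = 1) (η : ExtF K ℓ) :
    η = dP c0 * contr v η + contr v (dP c0 * η) := by
  rw [contr_dP_mul, hv]
  simp

theorem pullF_eq_zero (hv : ∑ i, c0 i * v i = 1) (hη : η ∈ logForms A p) : pullF D.π η = 0 := by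
  obtain ⟨ξ, hξ⟩ := (mem_logForms.1 hη).2 c0 D.mem
  rw [contr_decomp hv η, hξ, map_smul, map_add, D.pullF_dP_c0_mul, D.pullF_linP_c0_smul, add_zero]

theorem res_mem (hv : ∑ i, c0 i * v i = 1) (hη : η ∈ logForms A p) : pullF D.π (contr v η) ∈ logForms B (p - 1) := by
  have h0 := D.pullF_eq_zero hv hη
  rw [mem_logForms] at hη ⊢
  refine ⟨pullF_mem _ (contr_mem v hη.1), fun c' hc' => ?_⟩
  obtain ⟨c, hc, _, t, ht, h⟩ := D.exists_lift c' hc'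
  obtain ⟨ξ, hξ⟩ := hη.2 c hc
  have h1 := congrArg (contr v) hξ
  rw [contr_dP_mul, map_smul] at h1
  replace h1 := congrArg (pullF D.π) h1
  rw [map_sub, pullF_smul, h0, smul_zero, zero_sub, map_mul, pullF_dP, pullF_smul, linSubst_linP, h, dP_smul,
    linP_smul, mul_smul, smul_mul_assoc, ← smul_neg] at h1
  have hC : (C t : PS K m) ≠ 0 := by simpa using ht
  exact ⟨- pullF D.π (contr v ξ), by
    rw [smul_neg, ← smul_right_injective _ hC h1, neg_neg]⟩

/-- The residue map along the hyperplane. -/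
def res (hv : ∑ i, c0 i * v i = 1) (p : ℕ) :
    logForms A p →ₗ[PS K ℓ] ViaHom (linSubst D.π : PS K ℓ →+* PS K m) (logForms B (p - 1)) where
  toFun η := ViaHom.mk _ _ ⟨pullF D.π (contr v η), D.res_mem hv η.2⟩
  map_add' η ξ := by
    rw [← map_add]
    congr 1
    ext1
    simp
  map_smul' f η := by
    rw [RingHom.id_apply, ViaHom.smul_mk]
    congr 1
    ext1
    change pullF D.π (contr v (f • (η : ExtF K ℓ))) = linSubst D.π f • pullF D.π (contr v η)
    rw [map_smul, pullF_smul]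

theorem mulForm_injective (D : Restriction A c0 B) (p : ℕ) : Function.Injective (mulForm A c0 p) := by
  intro η ξ h
  have := congrArg Subtype.val h
  rw [coe_mulForm, coe_mulForm] at this
  exact Subtype.ext (smul_right_injective _ (fun h => D.ne_zero (linP_injective h)) this)

theorem exists_mulForm_eq (hv : ∑ i, c0 i * v i = 1) (η : logForms A p) (h : pullF D.π (contr v η) = 0) :
    ∃ η', mulForm A c0 p η' = η := by
  obtain ⟨η, hη⟩ := η
  obtain ⟨ξ, ζ, h1⟩ := D.exists_of_pullF_eq_zero h
  have hη' := mem_logForms.1 hη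
  obtain ⟨ξ0, h2⟩ := hη'.2 c0 D.mem
  have hne : linP c0 ≠ 0 := fun h => D.ne_zero (linP_injective h)
  have h3 : η = linP c0 • (dP c0 * ξ + contr v ξ0) := by
    conv_lhs => rw [contr_decomp hv η]
    simp only at h1
    rw [h1, h2, mul_add, dP_mul_dP_mul_self, add_zero, map_smul, mul_smul_comm, smul_add]
  have h4 : dP c0 * ξ + contr v ξ0 ∈ logForms (delArr A c0) p := by
    rw [mem_logForms]
    refine ⟨mem_formsP_of_smul_mem hne (h3 ▸ hη'.1), fun c hc => ?_⟩
    rw [mem_delArr] at hc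
    obtain ⟨ξ', h'⟩ := hη'.2 c hc.2
    rw [h3, mul_smul_comm] at h'
    exact exists_smul_of_smul_eq (linP_prime (A.ne_zero c hc.2))
      (linP_not_dvd A hc.2 D.mem hc.1) h'
  exact ⟨⟨_, h4⟩, Subtype.ext h3.symm⟩

theorem res_exact (p : ℕ) : Function.Exact (mulForm A c0 p) (D.res hv p) := by
  intro η
  constructor
  · intro h
    exact D.exists_mulForm_eq hv η (congrArg Subtype.val ((ViaHom.mk _ _).injective h))
  · rintro ⟨η, rfl⟩
    refine (congrArg (ViaHom.mk _ _) (Subtype.ext ?_)).trans (map_zero (ViaHom.mk _ _))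
    change pullF D.π (contr v (mulForm A c0 p η)) = 0
    rw [coe_mulForm, map_smul, D.pullF_linP_c0_smul]

theorem pdLE_zero (D : Restriction A c0 B) (h : pdLE (PS K ℓ) 0 (logForms (delArr A c0) 0)) :
    pdLE (PS K ℓ) 0 (logForms A 0) := by
  obtain ⟨v, hv⟩ := exists_sum_mul_eq_one D.ne_zero
  refine h.of_equiv (LinearEquiv.ofBijective (mulForm A c0 0) ⟨D.mulForm_injective 0, fun η => ?_⟩)
  exact D.exists_mulForm_eq hv η (by
    rw [contr_eq_zero _ (mem_logForms.1 η.2).1, map_zero])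

end Restriction

end LogForms

section Syzygy

open TensorProduct Polynomial

variable {R : Type} [CommRing R]

theorem exact_baseChange_ker {R' : Type} [CommRing R'] [Algebra R R'] {F M : Type}
    [AddCommGroup F] [AddCommGroup M] [Module R F] [Module R M] (f : F →ₗ[R] M)
    (hf : Function.Surjective f) :
    Function.Exact ((LinearMap.ker f).subtype.baseChange R') (f.baseChange R') :=
  lTensor_exact R' (LinearMap.exact_subtype_ker_map f) hf

theorem pdLE.baseChange {R' : Type} [CommRing R'] [Algebra R R'] [Module.Flat R R'] {n : ℕ}
    {M : Type} [AddCommGroup M] [Module R M] (h : pdLE R n M) : pdLE R' n (R' ⊗[R] M) := by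
  induction n generalizing M with
  | zero =>
    have : Module.Projective R M := h
    exact inferInstanceAs (Module.Projective R' (R' ⊗[R] M))
  | succ n ih =>
    obtain ⟨ι, f, hf, h⟩ := h
    refine pdLE_right ((LinearMap.ker f).subtype.baseChange R') (f.baseChange R') ?_ ?_ ?_ (ih h)
      (pdLE_of_projective _)
    · exact Module.Flat.lTensor_preserves_injective_linearMap _ (LinearMap.ker f).injective_subtype
    · exact exact_baseChange_ker f hf
    · exact LinearMap.lTensor_surjective R' hf

variable {M : Type} [AddCommGroup M] [Module R M]

/-- The coefficient of `X ^ i` in an element of `R[X] ⊗ M`. -/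
def tensorCoeff (R M : Type) [CommRing R] [AddCommGroup M] [Module R M] (i : ℕ) :
    R[X] ⊗[R] M →ₗ[R] M :=
  (TensorProduct.lid R M).toLinearMap ∘ₗ (Polynomial.lcoeff R i).rTensor M

@[simp] theorem tensorCoeff_tmul (i : ℕ) (f : R[X]) (m : M) :
    tensorCoeff R M i (f ⊗ₜ m) = f.coeff i • m := by
  simp [tensorCoeff]

theorem eq_sum_tensorCoeff (u : R[X] ⊗[R] M) :
    ∃ N, ∀ n ≥ N, u = ∑ i ∈ Finset.range n, (Polynomial.X ^ i : R[X]) ⊗ₜ tensorCoeff R M i u ∧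
      tensorCoeff R M n u = 0 := by
  induction u using TensorProduct.induction_on with
  | zero => exact ⟨0, by simp⟩
  | tmul f m =>
    refine ⟨f.natDegree + 1, fun n hn => ⟨?_, ?_⟩⟩
    · conv_lhs => rw [f.as_sum_range' n hn]
      rw [TensorProduct.sum_tmul]
      refine Finset.sum_congr rfl fun i _ => ?_
      rw [tensorCoeff_tmul, ← TensorProduct.smul_tmul, Polynomial.smul_eq_C_mul, Polynomial.C_mul_X_pow_eq_monomial]
    · rw [tensorCoeff_tmul, Polynomial.coeff_eq_zero_of_natDegree_lt hn, zero_smul]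
  | add u w hu hw =>
    obtain ⟨N, hN⟩ := hu
    obtain ⟨N', hN'⟩ := hw
    refine ⟨max N N', fun n hn => ⟨?_, ?_⟩⟩
    · simp only [map_add, TensorProduct.tmul_add, Finset.sum_add_distrib]
      rw [← (hN n (le_of_max_le_left hn)).1, ← (hN' n (le_of_max_le_right hn)).1]
    · rw [map_add, (hN n (le_of_max_le_left hn)).2, (hN' n (le_of_max_le_right hn)).2, add_zero]

theorem tensorCoeff_X_smul (i : ℕ) (u : R[X] ⊗[R] M) :
    tensorCoeff R M (i + 1) ((Polynomial.X : R[X]) • u) = tensorCoeff R M i u := by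
  induction u using TensorProduct.induction_on with
  | zero => simp
  | tmul f m => simp [TensorProduct.smul_tmul']
  | add u w hu hw => simp [hu, hw]

theorem tensorCoeff_baseChange (i : ℕ) (t : M →ₗ[R] M) (u : R[X] ⊗[R] M) :
    tensorCoeff R M i (t.baseChange R[X] u) = t (tensorCoeff R M i u) := by
  induction u using TensorProduct.induction_on with
  | zero => simp
  | tmul f m => simp
  | add u w hu hw => simp [hu, hw]

theorem pdLE_polynomial [Module R[X] M] [IsScalarTower R R[X] M] {n : ℕ} (h : pdLE R n M) :
    pdLE R[X] (n + 1) M := by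
  let t : M →ₗ[R] M := (LinearMap.lsmul R[X] M Polynomial.X).restrictScalars R
  let δ : R[X] ⊗[R] M →ₗ[R[X]] R[X] ⊗[R] M :=
    LinearMap.lsmul R[X] _ Polynomial.X - t.baseChange R[X]
  let π : R[X] ⊗[R] M →ₗ[R[X]] M := (LinearMap.id : M →ₗ[R] M).liftBaseChange R[X]
  have hδ : ∀ u, δ u = (Polynomial.X : R[X]) • u - t.baseChange R[X] u := fun _ => rfl
  refine pdLE_right δ π ?_ ?_ ?_ h.baseChange (h.baseChange.mono (Nat.le_succ n))
  · rw [injective_iff_map_eq_zero]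
    intro u hu
    have hrec : ∀ i, tensorCoeff R M i u = t (tensorCoeff R M (i + 1) u) := by
      intro i
      have := congrArg (tensorCoeff R M (i + 1)) hu
      rw [hδ, map_sub, tensorCoeff_X_smul, tensorCoeff_baseChange, map_zero] at this
      exact sub_eq_zero.1 this
    obtain ⟨N, hN⟩ := eq_sum_tensorCoeff u
    have hz : ∀ k, tensorCoeff R M (N - k) u = 0 := by
      intro k
      induction k with
      | zero => exact (hN N le_rfl).2
      | succ k ih =>
        by_cases hk : k < N
        · rw [hrec, show N - (k + 1) + 1 = N - k by lia, ih, map_zero]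
        · rw [show N - (k + 1) = N - k by lia, ih]
    rw [(hN N le_rfl).1]
    refine Finset.sum_eq_zero fun i hi => ?_
    have := hz (N - i)
    rw [show N - (N - i) = i by have := Finset.mem_range.1 hi; lia] at this
    rw [this, TensorProduct.tmul_zero]
  · intro u
    constructor
    · intro hu
      have key : ∀ (i : ℕ) (m : M), ((Polynomial.X ^ i : R[X]) ⊗ₜ[R] m -
          (1 : R[X]) ⊗ₜ[R] ((Polynomial.X ^ i : R[X]) • m)) ∈ LinearMap.range δ := by
        intro i
        induction i with
        | zero => simp
        | succ i ih =>
          intro m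
          have h1 : δ ((Polynomial.X ^ i : R[X]) ⊗ₜ[R] m) =
              (Polynomial.X ^ (i + 1) : R[X]) ⊗ₜ[R] m -
              (Polynomial.X ^ i : R[X]) ⊗ₜ[R] ((Polynomial.X : R[X]) • m) := by
            rw [hδ, TensorProduct.smul_tmul', smul_eq_mul, ← pow_succ',
              LinearMap.baseChange_tmul]
            rfl
          have h2 := ih ((Polynomial.X : R[X]) • m)
          rw [smul_smul, ← pow_succ] at h2
          have h3 := add_mem (LinearMap.mem_range_self δ ((Polynomial.X ^ i : R[X]) ⊗ₜ[R] m)) h2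
          rwa [h1, sub_add_sub_cancel] at h3
      obtain ⟨N, hN⟩ := eq_sum_tensorCoeff u
      have hu' : u - (1 : R[X]) ⊗ₜ[R] π u ∈ LinearMap.range δ := by
        have e := (hN N le_rfl).1
        have e2 : π u = ∑ i ∈ Finset.range N, (Polynomial.X ^ i : R[X]) • tensorCoeff R M i u := by
          conv_lhs => rw [e]
          simp [π]
        rw [e2, TensorProduct.tmul_sum]
        nth_rewrite 1 [e]
        rw [← Finset.sum_sub_distrib]
        exact Submodule.sum_mem _ fun i _ => key i _
      rw [hu, TensorProduct.tmul_zero, sub_zero] at hu'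
      exact hu'
    · rintro ⟨u, rfl⟩
      rw [hδ, map_sub, map_smul, sub_eq_zero]
      induction u using TensorProduct.induction_on with
      | zero => simp
      | tmul f m => simp [π, t, smul_smul, mul_comm]
      | add u w hu hw => rw [map_add, map_add, map_add, smul_add, hu, hw]
  · intro m
    exact ⟨1 ⊗ₜ m, by simp [π]⟩

theorem pdLE.of_ringEquiv {R' : Type} [CommRing R'] (e : R ≃+* R') {n : ℕ} {M : Type}
    [AddCommGroup M] [Module R' M] (h : pdLE R n (ViaHom (e : R →+* R') M)) : pdLE R' n M := by
  rw [pdLE_iff] at h ⊢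
  have : CategoryTheory.HasProjectiveDimensionLE
      (ModuleCat.of R (ViaHom (e : R →+* R') M)) n := h
  have := RingHomInvPair.of_ringEquiv e
  have := RingHomInvPair.of_ringEquiv e.symm
  exact ModuleCat.hasProjectiveDimensionLE_of_semiLinearEquiv (e := e)
    (M := ModuleCat.of R (ViaHom (e : R →+* R') M)) (N := ModuleCat.of R' M)
    { (ViaHom.mk (e : R →+* R') M).symm with map_smul' := fun _ _ => rfl } n

theorem pdLE_mvPolynomial (K : Type) [Field K] (ℓ : ℕ) (M : Type) [AddCommGroup M]
    [Module (PS K ℓ) M] : pdLE (PS K ℓ) ℓ M := by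
  induction ℓ generalizing M with
  | zero =>
    refine pdLE.of_ringEquiv (MvPolynomial.isEmptyAlgEquiv K (Fin 0)).symm.toRingEquiv ?_
    exact pdLE_of_projective 0
  | succ ℓ ih =>
    refine pdLE.of_ringEquiv (MvPolynomial.finSuccEquiv K ℓ).symm.toRingEquiv ?_
    set M' := ViaHom ((MvPolynomial.finSuccEquiv K ℓ).symm.toRingEquiv : (PS K ℓ)[X] →+* PS K (ℓ + 1)) M
    let : Module (PS K ℓ) M' := Module.compHom M' (Polynomial.C : PS K ℓ →+* (PS K ℓ)[X])
    have : IsScalarTower (PS K ℓ) (PS K ℓ)[X] M' := ⟨fun a f x => by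
      rw [Polynomial.smul_eq_C_mul, mul_smul]
      rfl⟩
    exact pdLE_polynomial (ih M')

end Syzygy

section ChangeOfRings

variable {R R' : Type} [CommRing R] [CommRing R'] (φ : R →+* R')

/-- A linear map viewed as a linear map over a smaller ring. -/
def ViaHom.map {M N : Type} [AddCommGroup M] [AddCommGroup N] [Module R' M] [Module R' N]
    (f : M →ₗ[R'] N) : ViaHom φ M →ₗ[R] ViaHom φ N where
  toFun x := ViaHom.mk φ N (f ((ViaHom.mk φ M).symm x))
  map_add' x y := by rw [map_add, map_add, map_add]
  map_smul' r x := map_smul f (φ r) ((ViaHom.mk φ M).symm x)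

variable {φ}

theorem pdLE_viaHom_finsupp [IsDomain R] {x : R} (hx : x ≠ 0) (hφ : Function.Surjective φ)
    (hker : ∀ r, φ r = 0 ↔ x ∣ r) (ι : Type) : pdLE R 1 (ViaHom φ (ι →₀ R')) := by
  let g : (ι →₀ R) →ₗ[R] ViaHom φ (ι →₀ R') :=
    { toFun := fun u => ViaHom.mk φ _ (u.mapRange φ (map_zero φ))
      map_add' := fun u w => by
        rw [← map_add]
        congr 1
        ext i
        simp
      map_smul' := fun r u => by
        rw [RingHom.id_apply, ViaHom.smul_mk]
        congr 1
        ext i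
        simp }
  refine pdLE_right (n := 0) (LinearMap.lsmul R (ι →₀ R) x) g (smul_right_injective _ hx) ?_ ?_
    (pdLE_of_projective _) (pdLE_of_projective _)
  · intro u
    constructor
    · intro hu
      have h : ∀ i, x ∣ u i := fun i => (hker _).1 (DFunLike.congr_fun (f := Finsupp.mapRange φ
        (map_zero φ) u) (g := (0 : ι →₀ R')) ((ViaHom.mk φ _).injective hu) i)
      choose w hw using h
      refine ⟨Finsupp.onFinset u.support w fun i hi => ?_, ?_⟩
      · rw [Finsupp.mem_support_iff, hw i]
        exact mul_ne_zero hx hi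
      · ext i
        simp [hw i]
    · rintro ⟨u, rfl⟩
      refine (congrArg (ViaHom.mk φ _) (?_ : _ = (0 : ι →₀ R'))).trans (map_zero (ViaHom.mk φ _))
      ext i
      simp [(hker x).2 dvd_rfl]
  · intro u
    obtain ⟨w, hw⟩ := Finsupp.mapRange_surjective φ (map_zero φ) hφ ((ViaHom.mk φ _).symm u)
    exact ⟨w, (ViaHom.mk φ _).symm.injective hw⟩

/-- Change of rings along the quotient by a nonzerodivisor. -/
theorem pdLE.viaHom [IsDomain R] {x : R} (hx : x ≠ 0) (hφ : Function.Surjective φ)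
    (hker : ∀ r, φ r = 0 ↔ x ∣ r) {n : ℕ} {M : Type} [AddCommGroup M] [Module R' M]
    (h : pdLE R' n M) : pdLE R (n + 1) (ViaHom φ M) := by
  induction n generalizing M with
  | zero =>
    have : Module.Projective R' M := h
    obtain ⟨s, hs⟩ := Module.projective_def'.1 this
    refine (pdLE_viaHom_finsupp hx hφ hker M).of_retract (ViaHom.map φ s)
      (ViaHom.map φ (Finsupp.linearCombination R' id)) ?_
    ext y
    exact LinearMap.congr_fun hs y
  | succ n ih =>
    obtain ⟨ι, f, hf, h⟩ := h
    refine pdLE_right (ViaHom.map φ (LinearMap.ker f).subtype) (ViaHom.map φ f) ?_ ?_ ?_ (ih h)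
      ((pdLE_viaHom_finsupp hx hφ hker ι).mono (by lia))
    · exact (LinearMap.ker f).injective_subtype
    · exact LinearMap.exact_subtype_ker_map f
    · exact hf

end ChangeOfRings

section KernelPresentation

variable {K : Type} [Field K] {ℓ m : ℕ}

/-- The linear map between free modules whose kernel is the module of logarithmic forms. -/
def logMap (A : Arrangement K ℓ) (p : ℕ) :
    (formsP K ℓ p × (A.hyps → ExtF K ℓ)) →ₗ[PS K ℓ] (A.hyps → ExtF K ℓ) :=
  LinearMap.pi fun c =>
    LinearMap.mulLeft (PS K ℓ) (dP (c : Fin ℓ → K)) ∘ₗ (formsP K ℓ p).subtype ∘ₗ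
        LinearMap.fst _ _ _ -
      linP (c : Fin ℓ → K) • LinearMap.proj c ∘ₗ LinearMap.snd _ _ _

theorem logMap_eq_zero {A : Arrangement K ℓ} {p : ℕ}
    {z : formsP K ℓ p × (A.hyps → ExtF K ℓ)} :
    logMap A p z = 0 ↔ ∀ c : A.hyps, dP (c : Fin ℓ → K) * (z.1 : ExtF K ℓ) =
      linP (c : Fin ℓ → K) • z.2 c := by
  rw [funext_iff]
  exact forall_congr' fun c => sub_eq_zero

/-- The logarithmic forms are the kernel of `logMap`. -/
def kerLogMapEquiv (A : Arrangement K ℓ) (p : ℕ) :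
    LinearMap.ker (logMap A p) ≃ₗ[PS K ℓ] logForms A p :=
  LinearEquiv.ofBijective
    (((formsP K ℓ p).subtype ∘ₗ LinearMap.fst _ _ _ ∘ₗ
      (LinearMap.ker (logMap A p)).subtype).codRestrict _ (fun z =>
        mem_logForms.2 ⟨z.1.1.2, fun c hc => ⟨_, logMap_eq_zero.1 z.2 ⟨c, hc⟩⟩⟩))
    ⟨by
      rw [injective_iff_map_eq_zero]
      rintro ⟨⟨η, ξ⟩, hz⟩ h
      have hη : η = 0 := Subtype.ext (show (η : ExtF K ℓ) = 0 from congrArg (Submodule.subtype _) h)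
      have hz' := logMap_eq_zero.1 hz
      simp only [hη, ZeroMemClass.coe_zero, mul_zero] at hz'
      have hξ : ξ = 0 := by
        ext1 c
        refine (smul_eq_zero.1 (hz' c).symm).resolve_left fun h0 => ?_
        exact A.ne_zero c c.2 (linP_injective h0)
      exact Subtype.ext (Prod.ext hη hξ),
    fun η => by
      have h := mem_logForms.1 η.2
      choose ξ hξ using h.2
      exact ⟨⟨(⟨η, h.1⟩, fun c => ξ c c.2), logMap_eq_zero.2 fun c => hξ c c.2⟩, rfl⟩⟩

theorem pdLE_logForms_of_le (A : Arrangement K ℓ) {p : ℕ} (hp : ℓ ≤ p + 2) :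
    pdLE (PS K ℓ) p (logForms A p) :=
  (pdLE_ker (logMap A p) ((pdLE_mvPolynomial K ℓ _).mono hp)).of_equiv (kerLogMapEquiv A p)

open RingTheory.Sequence in
theorem extVanish_logForms_one {P : Ideal (PS K ℓ)} (rs : List (PS K ℓ)) (hrs : ∀ r ∈ rs, r ∈ P)
    (hreg : IsWeaklyRegular (PS K ℓ) rs) (hlen : 2 ≤ rs.length) (hP : ∃ r ∈ P, r ≠ 0)
    (A : Arrangement K ℓ) (p : ℕ) : ExtVanish P (logForms A p) 1 := by
  refine extVanish_of_middle_of_right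
    ((LinearMap.ker (logMap A p)).subtype ∘ₗ (kerLogMapEquiv A p).symm.toLinearMap)
    (logMap A p).rangeRestrict ?_ ?_ (LinearMap.surjective_rangeRestrict _) ?_ ?_
  · exact (LinearMap.ker (logMap A p)).injective_subtype.comp (kerLogMapEquiv A p).symm.injective
  · intro z
    constructor
    · intro hz
      refine ⟨kerLogMapEquiv A p ⟨z, congrArg Subtype.val hz⟩, ?_⟩
      simp
    · rintro ⟨η, rfl⟩
      exact Subtype.ext ((kerLogMapEquiv A p).symm η).2
  · exact extVanish_of_isWeaklyRegular rs hrs (isWeaklyRegular_of_flat rs hreg) _ (by lia)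
  · obtain ⟨r, hr, hr0⟩ := hP
    exact extVanish_zero fun q hq => (smul_eq_zero.1 (hq r hr)).resolve_left hr0

namespace Restriction

variable {A : Arrangement K ℓ} {c0 : Fin ℓ → K} {B : Arrangement K m} (D : Restriction A c0 B)

theorem pdLE_of_surjective {v : Fin ℓ → K} (hv : ∑ i, c0 i * v i = 1) {p : ℕ}
    (hB : pdLE (PS K m) (p - 1) (logForms B (p - 1))) (hp : 1 ≤ p)
    (hA : pdLE (PS K ℓ) p (logForms (delArr A c0) p)) (hs : Function.Surjective (D.res hv p)) :
    pdLE (PS K ℓ) p (logForms A p) := by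
  refine pdLE_middle (mulForm A c0 p) (D.res hv p) (D.mulForm_injective p) (D.res_exact hv p) hs
    hA ?_
  have h := hB.viaHom (φ := (linSubst D.π : PS K ℓ →+* PS K m)) (x := linP c0)
    (fun h => D.ne_zero (linP_injective h)) (fun f => ⟨_, D.linSubst_σ f⟩)
    (fun _ => D.linSubst_eq_zero)
  rwa [Nat.sub_add_cancel hp] at h

end Restriction

end KernelPresentation

section Free

variable {K : Type} [Field K] {ℓ : ℕ}

theorem mem_exteriorPower_of_smul_mem {R M : Type} [CommRing R] [IsDomain R] [AddCommGroup M]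
    [Module R M] [Module.Free R M] {f : R} (hf : f ≠ 0) {p : ℕ} {η : ExteriorAlgebra R M}
    (h : f • η ∈ ⋀[R]^p M) : η ∈ ⋀[R]^p M := by
  have := exteriorAlgebra_free (R := R) (E := M)
  have h1 := DirectSum.decompose_of_mem_same (fun i => ⋀[R]^i M) h
  rw [DirectSum.decompose_smul] at h1
  have h2 : f • ((DirectSum.decompose (fun i => ⋀[R]^i M) η p : ⋀[R]^p M) :
      ExteriorAlgebra R M) = f • η := h1
  rw [← smul_right_injective _ hf h2]
  exact SetLike.coe_mem _

theorem dP_mul_comm_of_mem {c : Fin ℓ → K} {η : ExtF K ℓ} (h : η ∈ formsP K ℓ 1) :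
    dP c * η = -(η * dP c) := by
  rw [formsP, pow_one] at h
  obtain ⟨u, rfl⟩ := h
  exact eq_neg_of_add_eq_zero_left (ExteriorAlgebra.ι_add_mul_swap _ _)

/-- The product of the linear forms of an arrangement. -/
def prodP (F : Arrangement K ℓ) : PS K ℓ := ∏ c ∈ F.hyps, linP c

theorem linP_ne_zero (F : Arrangement K ℓ) {c : Fin ℓ → K} (hc : c ∈ F.hyps) : linP c ≠ 0 :=
  fun h => F.ne_zero c hc (linP_injective h)

theorem prodP_ne_zero (F : Arrangement K ℓ) : prodP F ≠ 0 :=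
  Finset.prod_ne_zero_iff.2 fun _ hc => linP_ne_zero F hc

theorem exists_prodP_smul_eq (F : Arrangement K ℓ) {E : Type} [AddCommGroup E] [Module (PS K ℓ) E]
    [Module.Free (PS K ℓ) E] {η : E} (h : ∀ c ∈ F.hyps, ∃ ξ, η = linP c • ξ) :
    ∃ ξ, η = prodP F • ξ :=
  exists_prod_smul_eq _ _ (fun _ hc => linP_prime (F.ne_zero _ hc))
    (fun _ hc _ hd hcd => linP_not_dvd F hc hd hcd) h

theorem contr_split {v c : Fin ℓ → K} (hv : ∑ i, c i * v i = 1) {η ξ : ExtF K ℓ}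
    (h : dP c * η = linP c • ξ) : η = dP c * contr v η + linP c • contr v ξ := by
  rw [← map_smul, ← h, contr_dP_mul, hv, map_one, one_smul, add_sub_cancel]

theorem exists_wedge_eq (F : Arrangement K ℓ) {p : ℕ} {η ω : ExtF K ℓ} (hη : η ∈ logForms F 1)
    (hω : ω ∈ logForms F p) : ∃ ω' ∈ logForms F (p + 1), η * ω = prodP F • ω' := by
  rw [mem_logForms] at hη hω
  have key : ∀ c ∈ F.hyps, (∃ ξ, η * ω = linP c • ξ) ∧
      ∃ ξ, dP c * (η * ω) = (linP c * linP c) • ξ := by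
    intro c hc
    obtain ⟨v, hv⟩ := exists_sum_mul_eq_one (F.ne_zero c hc)
    obtain ⟨ξ, hξ⟩ := hη.2 c hc
    obtain ⟨ζ, hζ⟩ := hω.2 c hc
    have h1 := contr_split hv hξ
    have h2 := contr_split hv hζ
    obtain ⟨f, hf⟩ : ∃ f : PS K ℓ, contr v η = algebraMap _ _ f := by
      have := contr_mem v hη.1
      rw [formsP, Nat.sub_self, pow_zero] at this
      obtain ⟨f, hf⟩ := Submodule.mem_one.1 this
      exact ⟨f, hf.symm⟩
    constructor
    · refine ⟨dP c * contr v η * contr v ζ + contr v ξ * ω, ?_⟩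
      have h3 : dP c * contr v η * (dP c * contr v ω) = 0 := by
        rw [hf, ← Algebra.commutes, mul_assoc, dP_mul_dP_mul_self, mul_zero]
      calc η * ω = dP c * contr v η * ω + linP c • (contr v ξ * ω) := by
            conv_lhs => rw [h1]
            rw [add_mul, smul_mul_assoc]
        _ = dP c * contr v η * (dP c * contr v ω + linP c • contr v ζ)
            + linP c • (contr v ξ * ω) := by rw [← h2]
        _ = _ := by rw [mul_add, h3, zero_add, mul_smul_comm, smul_add]
    · refine ⟨ξ * contr v ζ, ?_⟩
      have h3 : ξ * dP c = 0 := by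
        refine (smul_eq_zero.1 ?_).resolve_left (linP_ne_zero F hc)
        rw [← smul_mul_assoc, ← hξ, mul_assoc, ← neg_eq_zero, ← mul_neg, ← dP_mul_comm_of_mem hη.1,
          dP_mul_dP_mul_self]
      calc dP c * (η * ω) = linP c • (ξ * ω) := by rw [← mul_assoc, hξ, smul_mul_assoc]
        _ = linP c • (ξ * (dP c * contr v ω + linP c • contr v ζ)) := by rw [← h2]
        _ = _ := by rw [mul_add, ← mul_assoc, h3, zero_mul, zero_add, mul_smul_comm, smul_smul]
  obtain ⟨ω', hω'⟩ := exists_prodP_smul_eq F fun c hc => (key c hc).1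
  refine ⟨ω', mem_logForms.2 ⟨?_, fun c hc => ?_⟩, hω'⟩
  · refine mem_formsP_of_smul_mem (prodP_ne_zero F) ?_
    rw [← hω', add_comm p 1, formsP, pow_add]
    exact Submodule.mul_mem_mul hη.1 hω.1
  · obtain ⟨ξ, hξ⟩ := (key c hc).2
    have hs : ¬ linP c ∣ ∏ d ∈ F.hyps.erase c, linP d := by
      rw [(linP_prime (F.ne_zero c hc)).dvd_finsetProd_iff]
      rintro ⟨d, hd, h⟩
      exact linP_not_dvd F hc (Finset.mem_of_mem_erase hd) (Finset.ne_of_mem_erase hd).symm h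
    refine exists_smul_of_smul_eq (linP_prime (F.ne_zero c hc)) hs (ξ := ξ)
      (smul_right_injective _ (linP_ne_zero F hc) ?_)
    dsimp only
    rw [smul_smul, smul_smul, ← hξ, Finset.mul_prod_erase _ _ hc, hω', mul_smul_comm]
    rfl

/-- The algebra map from the exterior algebra on the logarithmic one-forms to all forms. -/
def extIncl (F : Arrangement K ℓ) :
    ExteriorAlgebra (PS K ℓ) (logForms F 1) →ₐ[PS K ℓ] ExtF K ℓ :=
  ExteriorAlgebra.lift (PS K ℓ) ⟨(logForms F 1).subtype, fun η => by
    have h := (mem_logForms.1 η.2).1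
    rw [formsP, pow_one] at h
    obtain ⟨u, hu⟩ := h
    rw [Submodule.subtype_apply, ← hu]
    exact ExteriorAlgebra.ι_sq_zero _⟩

theorem extIncl_ι (F : Arrangement K ℓ) (η : logForms F 1) :
    extIncl F (ExteriorAlgebra.ι _ η) = η :=
  ExteriorAlgebra.lift_ι_apply _ _ _ _

theorem smul_ι_mem (F : Arrangement K ℓ) (u : Fin ℓ → PS K ℓ) :
    prodP F • ExteriorAlgebra.ι (PS K ℓ) u ∈ logForms F 1 := by
  rw [mem_logForms]
  refine ⟨Submodule.smul_mem _ _ ?_, fun c hc => ?_⟩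
  · rw [formsP, pow_one]
    exact ⟨u, rfl⟩
  · refine ⟨(∏ d ∈ F.hyps.erase c, linP d) • (dP c * ExteriorAlgebra.ι (PS K ℓ) u), ?_⟩
    rw [smul_smul, Finset.mul_prod_erase _ _ hc, mul_smul_comm]
    rfl

/-- Multiplication by the defining polynomial, from all one-forms to logarithmic one-forms. -/
def oneMul (F : Arrangement K ℓ) : (Fin ℓ → PS K ℓ) →ₗ[PS K ℓ] logForms F 1 :=
  (prodP F • (ExteriorAlgebra.ι (PS K ℓ) :
      (Fin ℓ → PS K ℓ) →ₗ[PS K ℓ] ExtF K ℓ)).codRestrict _ (smul_ι_mem F)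

/-- The map induced on exterior algebras by `oneMul`. -/
def extMul (F : Arrangement K ℓ) :
    ExtF K ℓ →ₐ[PS K ℓ] ExteriorAlgebra (PS K ℓ) (logForms F 1) :=
  ExteriorAlgebra.map (oneMul F)

theorem extMul_ι (F : Arrangement K ℓ) (u : Fin ℓ → PS K ℓ) :
    extMul F (ExteriorAlgebra.ι _ u) = ExteriorAlgebra.ι _ (oneMul F u) :=
  ExteriorAlgebra.map_apply_ι _ _

theorem coe_oneMul (F : Arrangement K ℓ) (u : Fin ℓ → PS K ℓ) :
    (oneMul F u : ExtF K ℓ) = prodP F • ExteriorAlgebra.ι (PS K ℓ) u := rfl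

theorem extIncl_extMul (F : Arrangement K ℓ) {p : ℕ} {η : ExtF K ℓ} (h : η ∈ formsP K ℓ p) :
    extIncl F (extMul F η) = prodP F ^ p • η := by
  refine formsP_induction (P := fun p η => extIncl F (extMul F η) = prodP F ^ p • η)
    ?_ ?_ ?_ ?_ ?_ p η h
  · simp
  · intro p x y hx hy
    rw [map_add, map_add, hx, hy, smul_add]
  · intro p f x hx
    rw [map_smul, map_smul, hx, smul_comm]
  · intro p j x _ hx
    rw [map_mul, map_mul, hx, dP, extMul_ι, extIncl_ι, coe_oneMul, smul_mul_smul_comm, ← pow_succ']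
  · intro p
    rw [map_zero, map_zero, smul_zero]

theorem extMul_mem (F : Arrangement K ℓ) {p : ℕ} {η : ExtF K ℓ} (h : η ∈ formsP K ℓ p) :
    extMul F η ∈ ⋀[PS K ℓ]^p (logForms F 1) := by
  refine formsP_induction (P := fun p η => extMul F η ∈ ⋀[PS K ℓ]^p (logForms F 1))
    ?_ ?_ ?_ ?_ ?_ p η h
  · rw [map_one, ExteriorAlgebra.exteriorPower, pow_zero]
    exact Submodule.one_le.1 le_rfl
  · intro p x y hx hy
    rw [map_add]
    exact add_mem hx hy
  · intro p f x hx
    rw [map_smul]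
    exact Submodule.smul_mem _ _ hx
  · intro p j x _ hx
    rw [map_mul, dP, extMul_ι, ExteriorAlgebra.exteriorPower, pow_succ']
    exact Submodule.mul_mem_mul ⟨_, rfl⟩ hx
  · intro p
    rw [map_zero]
    exact zero_mem _

theorem extMul_coe (F : Arrangement K ℓ) (η : logForms F 1) :
    extMul F η = prodP F • ExteriorAlgebra.ι (PS K ℓ) η := by
  have h := (mem_logForms.1 η.2).1
  rw [formsP, pow_one] at h
  obtain ⟨u, hu⟩ := h
  rw [← hu, extMul_ι, ← map_smul]
  congr 1
  refine Subtype.ext ?_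
  rw [coe_oneMul, hu]
  rfl

theorem extMul_extIncl (F : Arrangement K ℓ) {p : ℕ}
    {τ : ExteriorAlgebra (PS K ℓ) (logForms F 1)} (h : τ ∈ ⋀[PS K ℓ]^p (logForms F 1)) :
    extMul F (extIncl F τ) = prodP F ^ p • τ := by
  induction p generalizing τ with
  | zero =>
    rw [ExteriorAlgebra.exteriorPower, pow_zero] at h
    obtain ⟨f, rfl⟩ := Submodule.mem_one.1 h
    rw [pow_zero, one_smul, AlgHom.commutes, AlgHom.commutes]
  | succ p ih =>
    rw [ExteriorAlgebra.exteriorPower, pow_succ'] at h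
    induction h using Submodule.mul_induction_on' with
    | mem_mul_mem x hx y hy =>
      obtain ⟨η, rfl⟩ := hx
      rw [map_mul, map_mul, ih hy, extIncl_ι, extMul_coe, smul_mul_smul_comm, ← pow_succ']
    | add x _ y _ hx hy => rw [map_add, map_add, hx, hy, smul_add]

theorem exists_extIncl_eq (F : Arrangement K ℓ) {p : ℕ}
    {τ : ExteriorAlgebra (PS K ℓ) (logForms F 1)} (h : τ ∈ ⋀[PS K ℓ]^(p + 1) (logForms F 1)) :
    ∃ ω ∈ logForms F (p + 1), extIncl F τ = prodP F ^ p • ω := by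
  induction p generalizing τ with
  | zero =>
    rw [zero_add, ExteriorAlgebra.exteriorPower, pow_one] at h
    obtain ⟨η, rfl⟩ := h
    exact ⟨η, η.2, by rw [extIncl_ι, pow_zero, one_smul]⟩
  | succ p ih =>
    rw [ExteriorAlgebra.exteriorPower, pow_succ'] at h
    induction h using Submodule.mul_induction_on' with
    | mem_mul_mem x hx y hy =>
      obtain ⟨η, rfl⟩ := hx
      obtain ⟨ω, hω, h⟩ := ih hy
      obtain ⟨ω', hω', h'⟩ := exists_wedge_eq F η.2 hω
      exact ⟨ω', hω', by rw [map_mul, h, extIncl_ι, mul_smul_comm, h', smul_smul, ← pow_succ]⟩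
    | add x _ y _ hx hy =>
      obtain ⟨ω, hω, h⟩ := hx
      obtain ⟨ω', hω', h'⟩ := hy
      exact ⟨ω + ω', add_mem hω hω', by rw [map_add, h, h', smul_add]⟩

theorem exists_extMul_dP (F : Arrangement K ℓ) {c : Fin ℓ → K} (hc : c ∈ F.hyps) :
    ∃ τ, extMul F (dP c) = linP c • τ := by
  have hmem : (∏ d ∈ F.hyps.erase c, linP d) • dP c ∈ logForms F 1 := by
    rw [mem_logForms]
    refine ⟨Submodule.smul_mem _ _ ?_, fun d hd => ?_⟩
    · rw [formsP, pow_one]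
      exact ⟨_, rfl⟩
    · by_cases hdc : d = c
      · refine ⟨0, ?_⟩
        rw [hdc, mul_smul_comm, dP_mul_self, smul_zero, smul_zero]
      · refine ⟨(∏ e ∈ (F.hyps.erase c).erase d, linP e) • (dP d * dP c), ?_⟩
        rw [smul_smul, Finset.mul_prod_erase _ _ (Finset.mem_erase.2 ⟨hdc, hd⟩), mul_smul_comm]
  refine ⟨ExteriorAlgebra.ι _ ⟨_, hmem⟩, ?_⟩
  rw [← map_smul]
  refine (extMul_ι F _).trans (congrArg _ (Subtype.ext ?_))
  change prodP F • dP c = linP c • (∏ d ∈ F.hyps.erase c, linP d) • dP c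
  rw [smul_smul, Finset.mul_prod_erase _ _ hc]
  rfl

theorem exists_extMul_eq (F : Arrangement K ℓ) [Module.Free (PS K ℓ) (logForms F 1)] {p : ℕ}
    {ω : ExtF K ℓ} (hω : ω ∈ logForms F p) :
    ∃ τ ∈ ⋀[PS K ℓ]^p (logForms F 1), extMul F ω = prodP F • τ := by
  have := exteriorAlgebra_free (R := PS K ℓ) (E := logForms F 1)
  rw [mem_logForms] at hω
  obtain ⟨τ, hτ⟩ := exists_prodP_smul_eq F (η := extMul F ω) fun c hc => by
    obtain ⟨v, hv⟩ := exists_sum_mul_eq_one (F.ne_zero c hc)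
    obtain ⟨ξ, hξ⟩ := hω.2 c hc
    obtain ⟨τ, hτ⟩ := exists_extMul_dP F hc
    refine ⟨τ * extMul F (contr v ω) + extMul F (contr v ξ), ?_⟩
    conv_lhs => rw [contr_split hv hξ]
    rw [map_add, map_mul, map_smul, hτ, smul_add, smul_mul_assoc]
  exact ⟨τ, mem_exteriorPower_of_smul_mem (prodP_ne_zero F) (hτ ▸ extMul_mem F hω.1), hτ⟩

/-- The logarithmic forms of all positive degrees of a free arrangement are free. -/
theorem logForms_free (F : Arrangement K ℓ) (hF : Module.Free (PS K ℓ) (logForms F 1)) {p : ℕ}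
    (hp : 1 ≤ p) : Module.Free (PS K ℓ) (logForms F p) := by
  have := exteriorAlgebra_free (R := PS K ℓ) (E := logForms F 1)
  obtain ⟨p, rfl⟩ := Nat.exists_eq_add_of_le' hp
  let a : logForms F (p + 1) →ₗ[PS K ℓ] ExteriorAlgebra (PS K ℓ) (logForms F 1) :=
    (extMul F).toLinearMap ∘ₗ (logForms F (p + 1)).subtype
  let b : ⋀[PS K ℓ]^(p + 1) (logForms F 1) →ₗ[PS K ℓ] ExteriorAlgebra (PS K ℓ) (logForms F 1) :=
    prodP F • Submodule.subtype _
  have hQ := prodP_ne_zero F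
  have ha : Function.Injective a := by
    rw [injective_iff_map_eq_zero]
    intro ω hω
    have h := extIncl_extMul F (mem_logForms.1 ω.2).1
    rw [show extMul F ω = 0 from hω, map_zero] at h
    exact Subtype.ext ((smul_eq_zero.1 h.symm).resolve_left (pow_ne_zero _ hQ))
  have hb : Function.Injective b := fun x y h => Subtype.ext (smul_right_injective _ hQ h)
  have hab : LinearMap.range a = LinearMap.range b := by
    refine le_antisymm ?_ ?_
    · rintro _ ⟨ω, rfl⟩
      obtain ⟨τ, hτ, h⟩ := exists_extMul_eq F ω.2
      exact ⟨⟨τ, hτ⟩, h.symm⟩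
    · rintro _ ⟨τ, rfl⟩
      obtain ⟨ω, hω, h⟩ := exists_extIncl_eq F τ.2
      refine ⟨⟨ω, hω⟩, smul_right_injective _ (pow_ne_zero p hQ) ?_⟩
      change prodP F ^ p • extMul F ω = prodP F ^ p • prodP F • (τ : ExteriorAlgebra _ _)
      rw [← map_smul, ← h, extMul_extIncl F τ.2, smul_smul, pow_succ]
  exact Module.Free.of_equiv ((LinearEquiv.ofInjective b hb).trans
    ((LinearEquiv.ofEq _ _ hab.symm).trans (LinearEquiv.ofInjective a ha).symm))

end Free

section Surjectivity

variable {K : Type} [Field K] {ℓ m : ℕ}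

theorem exists_prime_forall_mem_iff {R N : Type} [CommRing R] [IsNoetherianRing R]
    [AddCommGroup N] [Module R N] {W : Submodule R N} (hW : W ≠ ⊤) :
    ∃ P : Ideal R, P.IsPrime ∧ ∃ z : N, ∀ r, r ∈ P ↔ r • z ∈ W := by
  have : Nontrivial (N ⧸ W) := Submodule.Quotient.nontrivial_iff.2 hW
  obtain ⟨P, hP⟩ := associatedPrimes.nonempty R (N ⧸ W)
  obtain ⟨hP, x, rfl⟩ := isAssociatedPrime_iff.1 hP
  obtain ⟨z, rfl⟩ := W.mkQ_surjective x
  refine ⟨_, hP, z, fun r => ?_⟩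
  rw [Submodule.mem_colon_singleton, ← map_smul, Submodule.mem_bot, Submodule.mkQ_apply,
    Submodule.Quotient.mk_eq_zero]

theorem exists_orthogonal {U : Submodule K (Fin ℓ → K)} (hU : U ≠ ⊤) :
    ∃ v : Fin ℓ → K, v ≠ 0 ∧ ∀ c ∈ U, ∑ i, c i * v i = 0 := by
  obtain ⟨f, hf, h⟩ := Submodule.exists_le_ker_of_lt_top U hU.lt_top
  have hsum : ∀ c, f c = ∑ i, c i * f (Pi.single i 1) := fun c => by
    conv_lhs => rw [pi_eq_sum_univ' c]
    simp
  refine ⟨fun i => f (Pi.single i 1), fun h0 => hf (LinearMap.ext fun c => ?_), fun c hc => ?_⟩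
  · rw [hsum]
    simp only [congrFun h0 _, Pi.zero_apply, mul_zero, Finset.sum_const_zero, LinearMap.zero_apply]
  · rw [← hsum]
    exact h hc

theorem logForms_le {A F : Arrangement K ℓ} (h : F.hyps ⊆ A.hyps) (p : ℕ) :
    logForms A p ≤ logForms F p := fun _ hη =>
  mem_logForms.2 ⟨(mem_logForms.1 hη).1, fun c hc => (mem_logForms.1 hη).2 c (h hc)⟩

theorem smul_mem_logForms {A F : Arrangement K ℓ} {s : PS K ℓ}
    (hs : ∀ c ∈ A.hyps, c ∈ F.hyps ∨ linP c ∣ s) {p : ℕ} {η : ExtF K ℓ} (hη : η ∈ logForms F p) :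
    s • η ∈ logForms A p := by
  rw [mem_logForms] at hη ⊢
  refine ⟨Submodule.smul_mem _ _ hη.1, fun c hc => ?_⟩
  rw [mul_smul_comm]
  rcases hs c hc with h | ⟨t, rfl⟩
  · obtain ⟨ξ, hξ⟩ := hη.2 c h
    exact ⟨s • ξ, by rw [hξ, smul_comm]⟩
  · exact ⟨t • (dP c * η), by rw [smul_smul]⟩

theorem isWeaklyRegular_X :
    RingTheory.Sequence.IsWeaklyRegular (PS K ℓ) (List.ofFn (X : Fin ℓ → PS K ℓ)) := by
  have h := isWeaklyRegular_linP (List.ofFn fun i : Fin ℓ => (Pi.single i 1 : Fin ℓ → K)) ?_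
  · rw [List.map_ofFn] at h
    rwa [show linP ∘ (fun i : Fin ℓ => (Pi.single i 1 : Fin ℓ → K)) = X from
      funext linP_single] at h
  · intro i hi hmem
    rw [List.length_ofFn] at hi
    have hle : Submodule.span K
        {c | c ∈ List.take i (List.ofFn fun i : Fin ℓ => (Pi.single i 1 : Fin ℓ → K))} ≤
        LinearMap.ker (LinearMap.proj ⟨i, hi⟩) := by
      rw [Submodule.span_le]
      intro c hc
      obtain ⟨j, hj, rfl⟩ := List.mem_take_iff_getElem.1 hc
      have : (⟨i, hi⟩ : Fin ℓ) ≠ ⟨j, by lia⟩ := by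
        intro h
        have := congrArg Fin.val h
        simp at hj
        lia
      simpa using Pi.single_eq_of_ne this 1
    have := hle hmem
    simp at this

theorem linP_dvd_prod_filter (A : Arrangement K ℓ) (q : (Fin ℓ → K) → Prop) {c : Fin ℓ → K}
    (hc : c ∈ A.hyps) (h : ¬ q c) : linP c ∣ ∏ d ∈ A.hyps.filter (fun d => ¬ q d), linP d :=
  Finset.dvd_prod_of_mem _ (Finset.mem_filter.2 ⟨hc, h⟩)

theorem prod_filter_notMem {P : Ideal (PS K ℓ)} (hP : P.IsPrime) (A : Arrangement K ℓ)
    (q : (Fin ℓ → K) → Prop) (h : ∀ c ∈ A.hyps, linP c ∈ P → q c) :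
    ∏ d ∈ A.hyps.filter (fun d => ¬ q d), linP d ∉ P := by
  rw [hP.prod_mem_iff]
  rintro ⟨d, hd, hdP⟩
  rw [Finset.mem_filter] at hd
  exact hd.2 (h d hd.1 hdP)

/-- Multiplication by a polynomial carrying the forms of `F` to forms of `A`. -/
def smulForm {A F : Arrangement K ℓ} {s : PS K ℓ} (hs : ∀ c ∈ A.hyps, c ∈ F.hyps ∨ linP c ∣ s)
    (p : ℕ) : logForms F p →ₗ[PS K ℓ] logForms A p :=
  ((LinearMap.lsmul (PS K ℓ) (ExtF K ℓ) s).comp (logForms F p).subtype).codRestrict _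
    fun η => smul_mem_logForms hs η.2

theorem coe_smulForm {A F : Arrangement K ℓ} {s : PS K ℓ}
    (hs : ∀ c ∈ A.hyps, c ∈ F.hyps ∨ linP c ∣ s) {p : ℕ} (η : logForms F p) :
    (smulForm hs p η : ExtF K ℓ) = s • (η : ExtF K ℓ) :=
  LinearMap.codRestrict_apply _ _ _

theorem smulForm_inclusion {A F : Arrangement K ℓ} {s : PS K ℓ}
    (hs : ∀ c ∈ A.hyps, c ∈ F.hyps ∨ linP c ∣ s) {p : ℕ} (h : logForms A p ≤ logForms F p)
    (η : logForms A p) : smulForm hs p (Submodule.inclusion h η) = s • η :=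
  Subtype.ext ((coe_smulForm hs _).trans (by rw [Submodule.coe_inclusion, Submodule.coe_smul]))

namespace Restriction

variable {A : Arrangement K ℓ} {c0 : Fin ℓ → K} {B : Arrangement K m} (D : Restriction A c0 B)
  {v : Fin ℓ → K} (hv : ∑ i, c0 i * v i = 1) {p : ℕ}

theorem smul_mem_range_res {s : PS K ℓ} {η : ExtF K ℓ} (hη : η ∈ logForms A p)
    {ζ : logForms B (p - 1)} (h : pullF D.π (contr v η) = linSubst D.π s • (ζ : ExtF K m)) :
    s • ViaHom.mk (linSubst D.π : PS K ℓ →+* PS K m) _ ζ ∈ LinearMap.range (D.res hv p) :=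
  ⟨⟨η, hη⟩, congrArg (ViaHom.mk _ _) (Subtype.ext h)⟩

theorem smul_mem_range_of_dvd (hp : 1 ≤ p) {s : PS K ℓ}
    (hs : ∀ c ∈ A.hyps, c ≠ c0 → linP c ∣ s)
    (z : ViaHom (linSubst D.π : PS K ℓ →+* PS K m) (logForms B (p - 1))) :
    s • z ∈ LinearMap.range (D.res hv p) := by
  obtain ⟨ζ, rfl⟩ := (ViaHom.mk _ _).surjective z
  refine D.smul_mem_range_res hv (η := s • (dP c0 * pullF D.σ ζ)) ?_ ?_
  · rw [mem_logForms]
    refine ⟨Submodule.smul_mem _ _ ?_, fun c hc => ?_⟩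
    · have h := dP_mul_mem c0 (pullF_mem D.σ (mem_logForms.1 ζ.2).1)
      rwa [Nat.sub_add_cancel hp] at h
    · by_cases h : c = c0
      · exact ⟨0, by rw [h, mul_smul_comm, dP_mul_dP_mul_self, smul_zero, smul_zero]⟩
      · obtain ⟨t, rfl⟩ := hs c hc h
        exact ⟨t • (dP c * (dP c0 * pullF D.σ ζ)), by rw [mul_smul_comm, smul_smul]⟩
  · rw [map_smul, pullF_smul, contr_dP_mul, hv, map_one, one_smul, map_sub, D.pullF_dP_c0_mul,
      sub_zero, D.pullF_σ]

theorem smul_mem_range_of_pencil (hp : 1 ≤ p) {s : PS K ℓ} {c1 : Fin ℓ → K} (hc1 : c1 ∈ A.hyps)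
    (hne : c1 ≠ c0) (hs : ∀ c ∈ A.hyps, c ∈ Submodule.span K {c0, c1} ∨ linP c ∣ s)
    (z : ViaHom (linSubst D.π : PS K ℓ →+* PS K m) (logForms B (p - 1))) :
    s • z ∈ LinearMap.range (D.res hv p) := by
  obtain ⟨ζ, rfl⟩ := (ViaHom.mk _ _).surjective z
  have hζ := mem_logForms.1 ζ.2
  obtain ⟨c', hc', t, ht, h1⟩ := D.exists_restr c1 hc1 hne
  obtain ⟨ξ, hξ⟩ := hζ.2 c' hc'
  have hξ' : dP (D.π c1) * (ζ : ExtF K m) = linP (D.π c1) • ξ := by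
    rw [h1, dP_smul, linP_smul, smul_mul_assoc, hξ, smul_smul]
  have hπ0 : D.π c1 ≠ 0 := h1 ▸ smul_ne_zero ht (B.ne_zero c' hc')
  obtain ⟨w, hw⟩ := exists_sum_mul_eq_one hπ0
  have hsplit := contr_split hw hξ'
  set a := pullF D.σ (contr w ζ) with ha
  set b := pullF D.σ (contr w ξ) with hb
  have hξm : ξ ∈ formsP K m p := by
    refine mem_formsP_of_smul_mem (f := linP (D.π c1)) (fun h => hπ0 (linP_injective h)) ?_
    rw [← hξ']
    have := dP_mul_mem (D.π c1) hζ.1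
    rwa [Nat.sub_add_cancel hp] at this
  have hbm : ∀ c, dP c * b ∈ formsP K ℓ p := fun c => by
    have := dP_mul_mem c (pullF_mem D.σ (contr_mem w hξm))
    rwa [Nat.sub_add_cancel hp] at this
  have ham : dP c0 * (dP c1 * a) ∈ formsP K ℓ p := by
    rcases hp.eq_or_lt with rfl | hp'
    · rw [ha, contr_eq_zero w hζ.1, map_zero, mul_zero, mul_zero]
      exact zero_mem _
    · have := dP_mul_mem c0 (dP_mul_mem c1 (pullF_mem D.σ (contr_mem w hζ.1)))
      rwa [show p - 1 - 1 + 1 + 1 = p by lia] at this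
  refine D.smul_mem_range_res hv (η := s • (dP c0 * (dP c1 * a) +
    (linP c1 • (dP c0 * b) - linP c0 • (dP c1 * b)))) ?_ ?_
  · rw [mem_logForms]
    refine ⟨Submodule.smul_mem _ _ (add_mem ham (sub_mem (Submodule.smul_mem _ _ (hbm c0))
      (Submodule.smul_mem _ _ (hbm c1)))), fun c hc => ?_⟩
    rcases hs c hc with h | ⟨r, rfl⟩
    · obtain ⟨x, y, rfl⟩ := Submodule.mem_span_pair.1 h
      refine ⟨-(s • (dP c0 * (dP c1 * b))), ?_⟩
      rw [dP_add, dP_smul, dP_smul, linP_add, linP_smul, linP_smul, mul_smul_comm]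
      simp only [add_mul, smul_mul_assoc, mul_add, mul_sub, mul_smul_comm, dP_mul_dP_mul_self,
        dP_mul_dP_mul_comm c1 c0, mul_zero, smul_zero, neg_zero]
      module
    · exact ⟨_, by rw [mul_smul_comm, mul_smul]⟩
  · rw [map_smul, pullF_smul]
    congr 1
    conv_rhs => rw [hsplit]
    rw [map_add, map_sub, map_smul, map_smul, map_add, map_sub, D.pullF_linP_c0_smul, sub_zero,
      pullF_smul, contr_dP_mul, contr_dP_mul v c0 b, hv, map_one, one_smul, one_smul, map_sub,
      map_sub, D.pullF_dP_c0_mul, D.pullF_dP_c0_mul, sub_zero, sub_zero, map_mul, pullF_dP, ha, hb,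
      D.pullF_σ, D.pullF_σ, linSubst_linP]

theorem linP_c0_smul
    (z : ViaHom (linSubst D.π : PS K ℓ →+* PS K m) (logForms B (p - 1))) : linP c0 • z = 0 := by
  obtain ⟨ζ, rfl⟩ := (ViaHom.mk _ _).surjective z
  refine (ViaHom.smul_mk _ _ _).trans ?_
  rw [RingHom.coe_coe, linSubst_linP, D.π_c0, linP_zero, zero_smul, map_zero]

theorem eq_zero_of_smul_eq_zero {r : PS K ℓ} (hr : linSubst D.π r ≠ 0)
    (z : ViaHom (linSubst D.π : PS K ℓ →+* PS K m) (logForms B (p - 1))) (h : r • z = 0) :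
    z = 0 := by
  obtain ⟨ζ, rfl⟩ := (ViaHom.mk _ _).surjective z
  rw [ViaHom.smul_mk, EmbeddingLike.map_eq_zero_iff] at h
  rw [(smul_eq_zero.1 h).resolve_left hr, map_zero]

theorem res_surjective (hlf : LocallyFreeAlong (delArr A c0) (fun _ => 1) c0)
    (hA : pdLE (PS K ℓ) p (logForms (delArr A c0) p)) (hp : 1 ≤ p) (hp' : p + 3 ≤ ℓ) :
    Function.Surjective (D.res hv p) := by
  rw [← LinearMap.range_eq_top]
  by_contra hW
  obtain ⟨P, hP, z, hz⟩ := exists_prime_forall_mem_iff hW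
  have h0 : linP c0 ∈ P := by
    rw [hz, D.linP_c0_smul]
    exact zero_mem _
  have notMem : ∀ {s : PS K ℓ}, s ∉ P → s • z ∉ LinearMap.range (D.res hv p) :=
    fun hs h => hs ((hz _).2 h)
  by_cases h1 : ∃ c1 ∈ A.hyps, c1 ≠ c0 ∧ linP c1 ∈ P
  swap
  · push Not at h1
    refine notMem (prod_filter_notMem hP A (· = c0) fun c hc hcP => ?_)
      (D.smul_mem_range_of_dvd hv hp (fun c hc h => linP_dvd_prod_filter A _ hc h) z)
    by_contra hne
    exact h1 c hc hne hcP
  obtain ⟨c1, hc1, hne, hc1P⟩ := h1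
  by_cases h2 : ∀ c ∈ A.hyps, linP c ∈ P → c ∈ Submodule.span K {c0, c1}
  · refine notMem (prod_filter_notMem hP A _ h2) (D.smul_mem_range_of_pencil hv hp hc1 hne
      (fun c hc => ?_) z)
    by_cases h : c ∈ Submodule.span K {c0, c1}
    · exact Or.inl h
    · exact Or.inr (linP_dvd_prod_filter A _ hc h)
  push Not at h2
  obtain ⟨c2, hc2, hc2P, hspan⟩ := h2
  have hmem : ∀ r ∈ [c0, c1, c2].map linP, r ∈ P := by simp [h0, hc1P, hc2P]
  have hreg : RingTheory.Sequence.IsWeaklyRegular (PS K ℓ) ([c0, c1, c2].map linP) := by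
    refine isWeaklyRegular_linP _ fun i hi => ?_
    match i with
    | 0 => simpa using D.ne_zero
    | 1 =>
      have : {c | c ∈ List.take 1 [c0, c1, c2]} = {c0} := by ext; simp
      rw [this, Submodule.mem_span_singleton]
      rintro ⟨t, ht⟩
      exact A.nonprop c1 hc1 c0 D.mem hne t ht.symm
    | 2 =>
      have : {c | c ∈ List.take 2 [c0, c1, c2]} = {c0, c1} := by ext; simp
      rw [this]
      exact hspan
  have hπ : linSubst D.π (linP c1) ≠ 0 := by
    obtain ⟨c', hc', t, ht, h⟩ := D.exists_restr c1 hc1 hne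
    rw [linSubst_linP, h]
    exact fun h => smul_ne_zero ht (B.ne_zero c' hc') (linP_injective h)
  have main {M' : Type} [AddCommGroup M'] [Module (PS K ℓ) M'] :=
    smul_mem_range_of_extVanish (P := P) (M' := M') (mulForm A c0 p) (D.res hv p)
    (D.mulForm_injective p) (D.res_exact hv p) (fun q hq => D.eq_zero_of_smul_eq_zero hπ q (hq _ hc1P))
    (extVanish_logForms_one _ hmem hreg (by simp)
      ⟨_, h0, fun h => D.ne_zero (linP_injective h)⟩ A p)
  by_cases hU : Submodule.span K {c | c ∈ A.hyps ∧ linP c ∈ P} = ⊤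
  · refine notMem ((Ideal.ne_top_iff_one P).1 hP.ne_top) (main LinearMap.id LinearMap.id 1
      (fun _ => (one_smul _ _).symm)
      (extVanish_of_pdLE (List.ofFn X) ?_ isWeaklyRegular_X p hA 2 ?_) z fun r hr => (hz r).1 hr)
    · have hle : (⊤ : Submodule K (Fin ℓ → K)) ≤
          { carrier := {c | linP c ∈ P}
            add_mem' := fun {a b} ha hb => by
              rw [Set.mem_ofPred_eq, linP_add]
              exact add_mem ha hb
            zero_mem' := by
              rw [Set.mem_ofPred_eq, linP_zero]
              exact zero_mem _
            smul_mem' := fun t c hc => by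
              rw [Set.mem_ofPred_eq, linP_smul]
              exact P.mul_mem_left _ hc } :=
        hU ▸ Submodule.span_le.2 fun c hc => hc.2
      intro r hr
      obtain ⟨i, rfl⟩ := List.mem_ofFn.1 hr
      rw [← linP_single]
      exact hle Submodule.mem_top
    · rw [List.length_ofFn]
      lia
  · obtain ⟨x, hx, hxU⟩ := exists_orthogonal hU
    have hx' : ∀ c ∈ A.hyps, linP c ∈ P → ∑ i, c i * x i = 0 :=
      fun c hc hcP => hxU c (Submodule.subset_span ⟨hc, hcP⟩)
    have hfree := hlf x hx (hx' c0 D.mem h0)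
    have hF := logForms_free _ hfree hp
    set F := locArr (delArr A c0) x
    set s := ∏ d ∈ A.hyps.filter (fun d => ¬ ∑ i, d i * x i = 0), linP d
    have hs : ∀ c ∈ (delArr A c0).hyps, c ∈ F.hyps ∨ linP c ∣ s := fun c hc => by
      by_cases h : ∑ i, c i * x i = 0
      · exact Or.inl (Finset.mem_filter.2 ⟨hc, h⟩)
      · exact Or.inr (linP_dvd_prod_filter A _ (mem_delArr.1 hc).2 h)
    refine notMem (prod_filter_notMem hP A _ hx') (main
      (Submodule.inclusion (logForms_le (Finset.filter_subset _ _) p))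
      (smulForm hs p) s (smulForm_inclusion hs _)
      (extVanish_of_pdLE _ hmem hreg 0 (Module.Projective.of_free (P := logForms F p)) 2 (by simp)) z
      fun r hr => (hz r).1 hr)

end Restriction

end Surjectivity

/-- **Addition theorem for tameness II.**  If the restriction `A^H` is tame and
`A' = A ∖ {H}` is locally free along `H`, then `A` is tame whenever `A'` is tame. -/
theorem addition_theorem_for_tameness_II
    {K : Type} [Field K] {ℓ : ℕ} (A : Arrangement K ℓ) (hess : Essential A)
    (c0 : Fin ℓ → K) (hc0 : c0 ∈ A.hyps)
    (hrest_tame : ∃ (e : (Fin (ℓ - 1) → K) →ₗ[K] (Fin ℓ → K)) (B : Arrangement K (ℓ - 1)),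
      IsHypEmbedding c0 e ∧ IsRestrictionOf B A c0 e ∧ Tame B)
    (hlf' : LocallyFreeAlong (delArr A c0) (fun _ => 1) c0)
    (hdel_tame : Tame (delArr A c0)) :
    Tame A := by
  obtain ⟨e, B, he, hB, hBt⟩ := hrest_tame
  obtain ⟨D⟩ := exists_restriction hc0 he hB
  intro p hpl
  rcases Nat.eq_zero_or_pos p with rfl | hp
  · exact D.pdLE_zero (hdel_tame 0 hpl)
  rcases Nat.lt_or_ge (p + 2) ℓ with hlt | hge
  · obtain ⟨v, hv⟩ := exists_sum_mul_eq_one D.ne_zero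
    exact D.pdLE_of_surjective hv (hBt _ (Nat.sub_le_sub_right hpl 1)) hp (hdel_tame p hpl)
      (D.res_surjective hv hlf' (hdel_tame p hpl) hp hlt)
  · exact pdLE_logForms_of_le A hge
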